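/- arXiv:1012.3897 — 2 statements merged into one kernel-verified Lean document; each statement's English description precedes it below -/
import Mathlib

section
/- For all odd primes p < q < r < s, the height of the cyclotomic polynomial Φ_{pqrs} is at most (3/4)·p³q. -/
open Polynomial

/-- The height of an integer polynomial: the maximum of the absolute values of its
coefficients (`0` for the zero polynomial). -/
noncomputable def polyHeight (f : ℤ[X]) : ℕ := f.support.sup fun m => (f.coeff m).natAbs

/-- `A n` is the height of the `n`-th cyclotomic polynomial. -/
noncomputable def A (n : ℕ) : ℕ := polyHeight (cyclotomic n ℤ)

/-- Two coprime integers `p, q > 1` satisfy `x q + y p = p q + 1` with `0 < x < p`, `0 < y < q`. -/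
theorem exists_mul_add_mul_eq_mul_add_one {p q : ℕ} (h : q.Coprime p) (hp : 1 < p) (hq : 1 < q) :
    ∃ x y : ℕ, 0 < x ∧ x < p ∧ 0 < y ∧ y < q ∧ x * q + y * p = p * q + 1 := by
  obtain ⟨x, hxp, hx⟩ := Nat.exists_mul_mod_eq_one_of_coprime h hp
  have hz := Nat.div_add_mod (q * x) p
  rw [hx] at hz
  generalize q * x / p = z at hz
  have hx0 : 0 < x := by
    rcases Nat.eq_zero_or_pos x with h0 | h0
    · subst h0; omega
    · exact h0
  have hz0 : 0 < z := by
    rcases Nat.eq_zero_or_pos z with h0 | h0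
    · rw [h0] at hz
      nlinarith
    · exact h0
  have hzq : z < q := by nlinarith
  refine ⟨x, q - z, hx0, hxp, by omega, by omega, ?_⟩
  obtain ⟨y, rfl⟩ := Nat.exists_eq_add_of_lt hzq
  rw [show z + y + 1 - z = y + 1 by omega]
  nlinarith

theorem emod_eq_emod_sub_add_ite {p x y R k : ℤ} (hp : 0 < p) (hR : 0 ≤ R) (hRp : R < p)
    (h : y = x - R + p * k) : y % p = x % p - R + if x % p < R then p else 0 := by
  have h1 := Int.emod_nonneg x hp.ne'
  have h2 := Int.emod_lt_of_pos x hp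
  have h3 := Int.emod_add_mul_ediv x p
  split_ifs with hlt
  · have : y = (x % p - R + p) + p * (x / p + k - 1) := by linarith
    rw [this, Int.add_mul_emod_self_left, Int.emod_eq_of_lt (by omega) (by omega)]
  · have : y = (x % p - R) + p * (x / p + k) := by linarith
    rw [this, Int.add_mul_emod_self_left, Int.emod_eq_of_lt (by omega) (by omega), add_zero]

/-- A run of `p` consecutive integers, scaled by a unit modulo `p`, hits each residue once. -/
theorem sum_range_sub_mul_emod {p : ℕ} (hp : 0 < p) {k : ℤ} (hk : IsCoprime (p : ℤ) k) (n : ℤ)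
    (f : ℤ → ℤ) :
    ∑ i ∈ Finset.range p, f ((n - i) * k % p) = ∑ j ∈ Finset.range p, f j := by
  have hp' : (0 : ℤ) < p := by exact_mod_cast hp
  have hnn : ∀ i : ℕ, 0 ≤ (n - i) * k % p := fun i => Int.emod_nonneg _ hp'.ne'
  have hlt : ∀ i : ℕ, (n - i) * k % p < p := fun i => Int.emod_lt_of_pos _ hp'
  have hmaps : Set.MapsTo (fun i : ℕ => ((n - i) * k % p).toNat)
      (Finset.range p : Set ℕ) (Finset.range p : Set ℕ) := by
    intro i _
    have h1 := hnn i
    have h2 := hlt i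
    simp only [Finset.coe_range, Set.mem_Iio]
    omega
  have hinj : Set.InjOn (fun i : ℕ => ((n - i) * k % p).toNat) (Finset.range p : Set ℕ) := by
    intro i hi j hj hij
    simp only [Finset.coe_range, Set.mem_Iio] at hi hj
    have h1 := hnn i
    have h2 := hnn j
    have h3 : (n - i) * k % p = (n - j) * k % p := by
      have : (((n - i) * k % p).toNat : ℤ) = ((n - j) * k % p).toNat := congrArg _ hij
      rwa [Int.toNat_of_nonneg h1, Int.toNat_of_nonneg h2] at this
    have h4 : (p : ℤ) ∣ ((j : ℤ) - i) * k := by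
      have := Int.ModEq.dvd (show (n - j) * k ≡ (n - i) * k [ZMOD p] from h3.symm)
      convert this using 1; ring
    have h5 := hk.dvd_of_dvd_mul_right h4
    have h6 := Int.eq_zero_of_abs_lt_dvd h5 (by rw [abs_lt]; constructor <;> omega)
    omega
  refine Finset.sum_nbij _ hmaps hinj ?_ ?_
  · exact Finset.surjOn_of_injOn_of_card_le _ hmaps hinj le_rfl
  · intro i _
    rw [Int.toNat_of_nonneg (hnn i)]

/-- The product `1 / ((1 - X^{qr}) (1 - X^{pr}) (1 - X^{pq}))`, multiplied by `(1 - X^{pqr})^3`. -/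
noncomputable def tripleGeom (p q r : ℕ) : ℤ[X] :=
  ∑ a ∈ Finset.range p, ∑ b ∈ Finset.range q, ∑ c ∈ Finset.range r,
    X ^ (a * (q * r) + b * (p * r) + c * (p * q))

theorem tripleGeom_mul (p q r : ℕ) :
    tripleGeom p q r * ((X ^ (q * r) - 1) * (X ^ (p * r) - 1) * (X ^ (p * q) - 1)) =
      (X ^ (p * q * r) - 1) ^ 3 := by
  have h1 : tripleGeom p q r = (∑ a ∈ Finset.range p, (X ^ (q * r)) ^ a) *
      (∑ b ∈ Finset.range q, (X ^ (p * r)) ^ b) * ∑ c ∈ Finset.range r, (X ^ (p * q)) ^ c := by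
    rw [Finset.sum_mul_sum, Finset.sum_mul]
    refine Finset.sum_congr rfl fun a _ => ?_
    rw [Finset.sum_mul]
    refine Finset.sum_congr rfl fun b _ => ?_
    rw [Finset.mul_sum]
    refine Finset.sum_congr rfl fun c _ => ?_
    ring
  have ha := geom_sum_mul (X ^ (q * r) : ℤ[X]) p
  have hb := geom_sum_mul (X ^ (p * r) : ℤ[X]) q
  have hc := geom_sum_mul (X ^ (p * q) : ℤ[X]) r
  rw [← pow_mul] at ha hb hc
  rw [show q * r * p = p * q * r by ring] at ha
  rw [show p * r * q = p * q * r by ring] at hb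
  calc _ = ((∑ a ∈ Finset.range p, (X ^ (q * r)) ^ a) * (X ^ (q * r) - 1)) *
      ((∑ b ∈ Finset.range q, (X ^ (p * r)) ^ b) * (X ^ (p * r) - 1)) *
      ((∑ c ∈ Finset.range r, (X ^ (p * q)) ^ c) * (X ^ (p * q) - 1) : ℤ[X]) := by
        rw [h1]; ring
    _ = _ := by rw [ha, hb, hc]; ring

theorem coeff_tripleGeom (p q r n : ℕ) :
    (tripleGeom p q r).coeff n = ∑ a ∈ Finset.range p, ∑ b ∈ Finset.range q,
      ∑ c ∈ Finset.range r, if n = a * (q * r) + b * (p * r) + c * (p * q) then 1 else 0 := by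
  simp [tripleGeom, finsetSum_coeff, coeff_X_pow]

section Cyclotomic

variable {p q r : ℕ}

theorem expand_cyclotomic_prime_mul (hp : p.Prime) (d : ℕ) :
    expand ℤ d (cyclotomic p ℤ) * (X ^ d - 1) = X ^ (p * d) - 1 := by
  have := Fact.mk hp
  have h := congrArg (expand ℤ d) (cyclotomic_prime_mul_X_sub_one ℤ p)
  simpa [expand_X, ← pow_mul, mul_comm d p] using h

theorem cyclotomic_mul_prime_mul_cyclotomic {n : ℕ} (hr : r.Prime) (hn : ¬ r ∣ n) :
    cyclotomic (n * r) ℤ * cyclotomic n ℤ = expand ℤ r (cyclotomic n ℤ) :=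
  (cyclotomic_expand_eq_cyclotomic_mul hr hn ℤ).symm

theorem cyclotomic_two_primes_mul (hp : p.Prime) (hq : q.Prime) (hqp : ¬ q ∣ p) :
    cyclotomic (p * q) ℤ * ((X ^ p - 1) * (X ^ q - 1)) = (X ^ (p * q) - 1) * (X - 1) := by
  have h1 := expand_cyclotomic_prime_mul hp q
  have h2 := expand_cyclotomic_prime_mul hp 1
  simp only [expand_one, pow_one, mul_one] at h2
  have h3 := cyclotomic_mul_prime_mul_cyclotomic hq hqp
  rw [← h1, ← h2, ← h3]; ring

/-- The inverse cyclotomic polynomial of order `pqr`, in factored form. -/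
theorem cyclotomic_three_primes_mul (hp : p.Prime) (hq : q.Prime) (hr : r.Prime) (hqp : ¬ q ∣ p)
    (hrpq : ¬ r ∣ p * q) :
    cyclotomic (p * q * r) ℤ * (cyclotomic (p * q) ℤ * expand ℤ r (cyclotomic p ℤ) *
      (X ^ (q * r) - 1)) = X ^ (p * q * r) - 1 := by
  have h1 := expand_cyclotomic_prime_mul hp (q * r)
  have h2 := congrArg (expand ℤ r) (cyclotomic_mul_prime_mul_cyclotomic hq hqp)
  have h3 := cyclotomic_mul_prime_mul_cyclotomic hr hrpq
  rw [map_mul, ← expand_mul, mul_comm r q] at h2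
  rw [mul_assoc p q r, ← h1, ← h2, ← mul_assoc p q r, ← h3]; ring

theorem cyclotomic_three_primes_mul_sq (hp : p.Prime) (hq : q.Prime) (hr : r.Prime)
    (hqp : ¬ q ∣ p) (hrpq : ¬ r ∣ p * q) :
    cyclotomic (p * q * r) ℤ * (1 - X ^ (p * q * r)) ^ 2 =
      (∑ i ∈ Finset.range p, X ^ i) * ((1 - X ^ q) * (1 - X ^ r)) * tripleGeom p q r := by
  have h1 := cyclotomic_three_primes_mul hp hq hr hqp hrpq
  have h2 := cyclotomic_two_primes_mul hp hq hqp
  have h3 := expand_cyclotomic_prime_mul hp r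
  have h4 := tripleGeom_mul p q r
  have h5 := geom_sum_mul (X : ℤ[X]) p
  set W := tripleGeom p q r
  set G : ℤ[X] := ∑ i ∈ Finset.range p, X ^ i
  have hne : ∀ {k : ℕ}, 0 < k → (X ^ k - 1 : ℤ[X]) ≠ 0 := fun hk => X_pow_sub_C_ne_zero hk 1
  have hp0 := hp.pos
  have hq0 := hq.pos
  have hr0 := hr.pos
  have hprod : ((X - 1 : ℤ[X]) * (X ^ (q * r) - 1) * (X ^ (p * r) - 1) * (X ^ (p * q) - 1)) ≠ 0 := by
    refine mul_ne_zero (mul_ne_zero (mul_ne_zero ?_ (hne ?_)) (hne ?_)) (hne ?_)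
    · simpa using hne (k := 1) one_pos
    all_goals positivity
  apply mul_right_cancel₀ hprod
  generalize expand ℤ r (cyclotomic p ℤ) = P at *
  generalize cyclotomic (p * q * r) ℤ = Φ at *
  generalize cyclotomic (p * q) ℤ = Ψ at *
  generalize (X ^ (p * q * r) : ℤ[X]) = xpqr at *
  generalize (X ^ (p * q) : ℤ[X]) = xpq at *
  generalize (X ^ (p * r) : ℤ[X]) = xpr at *
  generalize (X ^ (q * r) : ℤ[X]) = xqr at *
  generalize (X ^ p : ℤ[X]) = xp at *
  generalize (X ^ q : ℤ[X]) = xq at *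
  generalize (X ^ r : ℤ[X]) = xr at *
  have h6 : Φ * ((X - 1) * (xqr - 1) * (xpr - 1) * (xpq - 1)) =
      (xpqr - 1) * ((xp - 1) * (xq - 1) * (xr - 1)) := by
    rw [← h1, ← h3]
    linear_combination (-Φ * P * (xqr - 1) * (xr - 1)) * h2
  calc _ = (xpqr - 1) ^ 2 * (Φ * ((X - 1) * (xqr - 1) * (xpr - 1) * (xpq - 1))) := by ring
    _ = (xpqr - 1) ^ 3 * ((xp - 1) * (xq - 1) * (xr - 1)) := by rw [h6]; ring
    _ = _ := by rw [← h4, ← h5]; ring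

end Cyclotomic

/-- Multiplying by `∑ i < k, X^{d i}` enlarges a bound on the coefficients at most `k`-fold. -/
theorem abs_coeff_geom_sum_mul_le {D : ℤ[X]} {M : ℤ} (hD : ∀ t, |D.coeff t| ≤ M) (d k t : ℕ) :
    |((∑ i ∈ Finset.range k, (X ^ d) ^ i) * D).coeff t| ≤ k * M := by
  have hM : 0 ≤ M := (abs_nonneg _).trans (hD 0)
  have hterm : ∀ i ∈ Finset.range k, |((X ^ d) ^ i * D).coeff t| ≤ M := by
    intro i _
    rw [← pow_mul, coeff_X_pow_mul']
    split_ifs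
    · exact hD _
    · rwa [abs_zero]
  rw [Finset.sum_mul, finsetSum_coeff]
  refine (Finset.abs_sum_le_sum_abs _ _).trans ((Finset.sum_le_sum hterm).trans_eq ?_)
  rw [Finset.sum_const, Finset.card_range, nsmul_eq_mul]

theorem cyclotomic_two_primes_eq {p q x y : ℕ} (hp : p.Prime) (hq : q.Prime) (hqp : ¬ q ∣ p)
    (hxp : x < p) (hyq : y < q) (h : x * q + y * p = p * q + 1) :
    cyclotomic (p * q) ℤ =
      (∑ i ∈ Finset.range y, (X ^ p) ^ i) * ∑ j ∈ Finset.range x, (X ^ q) ^ j -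
      X ^ 1 * ((∑ i ∈ Finset.range (q - y), (X ^ p) ^ i) *
        ∑ j ∈ Finset.range (p - x), (X ^ q) ^ j) := by
  have hne : ∀ {k : ℕ}, 0 < k → (X ^ k - 1 : ℤ[X]) ≠ 0 := fun hk => X_pow_sub_C_ne_zero hk 1
  apply mul_right_cancel₀ (mul_ne_zero (hne hp.pos) (hne hq.pos))
  rw [cyclotomic_two_primes_mul hp hq hqp]
  obtain ⟨x', rfl⟩ := Nat.exists_eq_add_of_le hxp.le
  obtain ⟨y', rfl⟩ := Nat.exists_eq_add_of_le hyq.le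
  rw [Nat.add_sub_cancel_left, Nat.add_sub_cancel_left]
  set p := x + x'
  set q := y + y'
  have h1 := geom_sum_mul (X ^ p : ℤ[X]) y
  have h2 := geom_sum_mul (X ^ q : ℤ[X]) x
  have h3 := geom_sum_mul (X ^ p : ℤ[X]) y'
  have h4 := geom_sum_mul (X ^ q : ℤ[X]) x'
  have e1 : (X ^ p) ^ y * (X ^ q) ^ x = (X ^ (p * q) * X : ℤ[X]) := by
    rw [← pow_mul, ← pow_mul, ← pow_add, ← pow_succ, ← h]; congr 1; ring
  have e2 : (X * (X ^ p) ^ y') = ((X ^ q) ^ x : ℤ[X]) := by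
    rw [← pow_mul, ← pow_mul, ← pow_succ']; congr 1
    have : p * q = p * y + p * y' := by simp only [q]; ring
    nlinarith
  have e3 : (X * (X ^ q) ^ x') = ((X ^ p) ^ y : ℤ[X]) := by
    rw [← pow_mul, ← pow_mul, ← pow_succ']; congr 1
    have : p * q = x * q + x' * q := by simp only [p]; ring
    nlinarith
  have e4 : (X * ((X ^ p) ^ y' * (X ^ q) ^ x')) = (X ^ (p * q) : ℤ[X]) := by
    rw [← pow_mul, ← pow_mul, ← pow_add, ← pow_succ']; congr 1
    have : p * q = p * y + p * y' := by simp only [q]; ring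
    have : p * q = x * q + x' * q := by simp only [p]; ring
    nlinarith
  have hA : ((∑ i ∈ Finset.range y, (X ^ p) ^ i) * ∑ j ∈ Finset.range x, (X ^ q) ^ j) *
      ((X ^ p - 1) * (X ^ q - 1)) = ((X ^ p) ^ y - 1) * ((X ^ q) ^ x - 1 : ℤ[X]) := by
    rw [← h1, ← h2]; ring
  have hB : ((∑ i ∈ Finset.range y', (X ^ p) ^ i) * ∑ j ∈ Finset.range x', (X ^ q) ^ j) *
      ((X ^ p - 1) * (X ^ q - 1)) = ((X ^ p) ^ y' - 1) * ((X ^ q) ^ x' - 1 : ℤ[X]) := by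
    rw [← h3, ← h4]; ring
  rw [sub_mul ((∑ i ∈ Finset.range y, (X ^ p : ℤ[X]) ^ i) * _), hA, mul_assoc, hB, pow_one]
  linear_combination e4 - e1 - e2 - e3

/-- If `s` is prime to `N` and `deg f < N`, then `f(X^s)` has at most one exponent in each residue
class modulo `N`. -/
theorem coeff_expand_mul_geom_sum {f : ℤ[X]} {s N : ℕ} (hs : 0 < s) (hN : 0 < N)
    (hsN : N.Coprime s) (hf : f.natDegree < N) (K t : ℕ) :
    ((∑ k ∈ Finset.range K, (X ^ N) ^ k) * expand ℤ s f).coeff t = 0 ∨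
      ∃ j, ((∑ k ∈ Finset.range K, (X ^ N) ^ k) * expand ℤ s f).coeff t = f.coeff j := by
  have hterm : ∀ k, ((X ^ N) ^ k * expand ℤ s f).coeff t ≠ 0 →
      ∃ j, j < N ∧ N * k + s * j = t ∧ ((X ^ N) ^ k * expand ℤ s f).coeff t = f.coeff j := by
    intro k hk
    rw [← pow_mul, coeff_X_pow_mul', coeff_expand hs] at hk ⊢
    split_ifs at hk ⊢ with h1 h2
    · refine ⟨_, lt_of_le_of_lt (le_natDegree_of_ne_zero hk) hf, ?_, rfl⟩
      rw [Nat.mul_div_cancel' h2]; omega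
    · exact absurd rfl hk
    · exact absurd rfl hk
  rw [Finset.sum_mul, finsetSum_coeff]
  by_cases hall : ∀ k ∈ Finset.range K, ((X ^ N) ^ k * expand ℤ s f).coeff t = 0
  · exact Or.inl (Finset.sum_eq_zero hall)
  · push Not at hall
    obtain ⟨k, hkK, hk⟩ := hall
    obtain ⟨j, hj, hjt, hjc⟩ := hterm k hk
    refine Or.inr ⟨j, ?_⟩
    rw [← hjc]
    refine Finset.sum_eq_single k (fun k' _ hne => ?_) fun h => absurd hkK h
    by_contra hk'
    obtain ⟨j', hj', hjt', -⟩ := hterm k' hk'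
    have hmod : s * j ≡ s * j' [MOD N] := by
      have h1 : s * j + N * k ≡ s * j [MOD N] := by simp [Nat.ModEq]
      have h2 : s * j' + N * k' ≡ s * j' [MOD N] := by simp [Nat.ModEq]
      refine h1.symm.trans (Nat.ModEq.trans ?_ h2)
      rw [show s * j + N * k = s * j' + N * k' by omega]
    have hjj : j = j' := by
      have := Nat.ModEq.cancel_left_of_coprime hsN hmod
      rwa [Nat.ModEq, Nat.mod_eq_of_lt hj, Nat.mod_eq_of_lt hj'] at this
    subst hjj
    exact hne (Nat.eq_of_mul_eq_mul_left hN (by omega))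

/-- `X ^ k * W` has `n`-th coefficient `w (n - k)`, where `w` extends the coefficients of `W` by zero
to the negative integers. -/
theorem coeff_X_pow_mul_eq_of_forall {W : ℤ[X]} {w : ℤ → ℤ} (hw : ∀ n : ℕ, w n = W.coeff n)
    (hneg : ∀ t < 0, w t = 0) (k n : ℕ) : (X ^ k * W).coeff n = w (n - k) := by
  rw [coeff_X_pow_mul']
  split_ifs with h
  · rw [← hw, Nat.cast_sub h]
  · rw [hneg _ (by omega)]

theorem coeff_eq_sum_of_mul_eq {Φ W : ℤ[X]} {w : ℤ → ℤ} {N p q r n : ℕ}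
    (hw : ∀ n : ℕ, w n = W.coeff n) (hneg : ∀ t < 0, w t = 0) (hn : n < N)
    (h : Φ * (1 - X ^ N) ^ 2 = (∑ i ∈ Finset.range p, X ^ i) * ((1 - X ^ q) * (1 - X ^ r)) * W) :
    Φ.coeff n = ∑ i ∈ Finset.range p,
      (w (n - i) - w (n - i - q) - w (n - i - r) + w (n - i - r - q)) := by
  have h1 : Φ.coeff n = (Φ * (1 - X ^ N) ^ 2).coeff n := by
    have : Φ * (1 - X ^ N) ^ 2 = Φ + X ^ N * (Φ * (X ^ N - 2)) := by ring
    rw [this, coeff_add, coeff_X_pow_mul', if_neg (by omega), add_zero]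
  have h2 : (∑ i ∈ Finset.range p, X ^ i) * ((1 - X ^ q) * (1 - X ^ r)) * W =
      ∑ i ∈ Finset.range p,
        (X ^ i * W - X ^ (i + q) * W - X ^ (i + r) * W + X ^ (i + r + q) * W) := by
    rw [mul_assoc, Finset.sum_mul]
    refine Finset.sum_congr rfl fun i _ => ?_
    ring
  rw [h1, h, h2, finsetSum_coeff]
  refine Finset.sum_congr rfl fun i _ => ?_
  simp only [coeff_add, coeff_sub, coeff_X_pow_mul_eq_of_forall hw hneg]
  push_cast
  simp only [sub_sub, add_assoc]

theorem eq_of_dvd_sub_mul {p k x y : ℤ} (hk : IsCoprime p k) (hx : 0 ≤ x) (hxp : x < p)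
    (hy : 0 ≤ y) (hyp : y < p) (h : p ∣ (x - y) * k) : x = y := by
  have h1 := hk.dvd_of_dvd_mul_right h
  have := Int.eq_zero_of_abs_lt_dvd h1 (by rw [abs_lt]; constructor <;> omega)
  omega

/-- If `t = a qr + b pr + c pq - F pqr` with `a, b, c` reduced modulo `p, q, r`, then `t` is an
exponent of `tripleGeom p q r` exactly when `F = 0`. -/
theorem coeff_tripleGeom_eq_ite {p q r n : ℕ} (hpq : IsCoprime (p : ℤ) q) (hpr : IsCoprime (p : ℤ) r)
    (hqr : IsCoprime (q : ℤ) r) {a b c F : ℤ} (ha : 0 ≤ a) (hap : a < p) (hb : 0 ≤ b) (hbq : b < q)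
    (hc : 0 ≤ c) (hcr : c < r)
    (h : n + F * (p * q * r) = a * (q * r) + b * (p * r) + c * (p * q)) :
    (tripleGeom p q r).coeff n = if F = 0 then 1 else 0 := by
  lift a to ℕ using ha
  lift b to ℕ using hb
  lift c to ℕ using hc
  have hN : (p * q * r : ℤ) ≠ 0 := by
    have h1 : (p : ℤ) ≠ 0 := by omega
    have h2 : (q : ℤ) ≠ 0 := by omega
    have h3 : (r : ℤ) ≠ 0 := by omega
    positivity
  have key : ∀ a' ∈ Finset.range p, ∀ b' ∈ Finset.range q, ∀ c' ∈ Finset.range r,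
      n = a' * (q * r) + b' * (p * r) + c' * (p * q) → a' = a ∧ b' = b ∧ c' = c := by
    intro a' ha' b' hb' c' hc' hn
    rw [Finset.mem_range] at ha' hb' hc'
    zify at hn
    refine ⟨?_, ?_, ?_⟩ <;> zify
    · refine eq_of_dvd_sub_mul (p := p) (hpq.mul_right hpr) (by omega) (by omega) (by omega) hap
        ⟨(b - b') * r + (c - c') * q - F * q * r, ?_⟩
      linear_combination h - hn
    · refine eq_of_dvd_sub_mul (p := q) (hpq.symm.mul_right hqr) (by omega) (by omega) (by omega) hbq
        ⟨(a - a') * r + (c - c') * p - F * p * r, ?_⟩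
      linear_combination h - hn
    · refine eq_of_dvd_sub_mul (p := r) (hpr.symm.mul_right hqr.symm) (by omega) (by omega)
        (by omega) hcr ⟨(a - a') * q + (b - b') * p - F * p * q, ?_⟩
      linear_combination h - hn
  rw [coeff_tripleGeom]
  split_ifs with hF
  · rw [hF, zero_mul, add_zero] at h
    have h' : n = a * (q * r) + b * (p * r) + c * (p * q) := by exact_mod_cast h
    have ha : a ∈ Finset.range p := Finset.mem_range.2 (by omega)
    have hb : b ∈ Finset.range q := Finset.mem_range.2 (by omega)
    have hc : c ∈ Finset.range r := Finset.mem_range.2 (by omega)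
    rw [Finset.sum_eq_single_of_mem a ha, Finset.sum_eq_single_of_mem b hb,
      Finset.sum_eq_single_of_mem c hc, if_pos h']
    · exact fun c' hc' hne => if_neg fun hn => hne (key a ha b hb c' hc' hn).2.2
    · exact fun b' hb' hne => Finset.sum_eq_zero fun c' hc' =>
        if_neg fun hn => hne (key a ha b' hb' c' hc' hn).2.1
    · exact fun a' ha' hne => Finset.sum_eq_zero fun b' hb' => Finset.sum_eq_zero fun c' hc' =>
        if_neg fun hn => hne (key a' ha' b' hb' c' hc' hn).1
  · refine Finset.sum_eq_zero fun a' ha' => Finset.sum_eq_zero fun b' hb' =>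
      Finset.sum_eq_zero fun c' hc' => if_neg fun hn => hF ?_
    obtain ⟨rfl, rfl, rfl⟩ := key a' ha' b' hb' c' hc' hn
    zify at hn
    have : F * (p * q * r) = 0 := by linarith
    exact (mul_eq_zero.1 this).resolve_right hN

/-- The weight that bounds four times the contribution of one residue to a coefficient of a
ternary cyclotomic polynomial. -/
def ternaryWeight (A A' B : Prop) [Decidable A] [Decidable A'] [Decidable B] : ℤ :=
  if (A ↔ A') then (if (A ↔ B) then 4 else 0) else 2

theorem ternaryWeight_bounds {A A' B B' C : Prop} [Decidable A] [Decidable A'] [Decidable B]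
    [Decidable B'] [Decidable C] {k k₁ k₂ k₃ : ℤ}
    (h₁ : k₁ = k - 1 + (if A then 1 else 0) + if C then 1 else 0)
    (h₂ : k₂ = k - 1 + (if B then 1 else 0) + if B' then 1 else 0)
    (h₃ : k₃ = k₂ - 1 + (if A' then 1 else 0) + if C then 1 else 0)
    (hk : 0 ≤ k ∧ k ≤ 2) (hk₁ : 0 ≤ k₁ ∧ k₁ ≤ 2) (hk₂ : 0 ≤ k₂ ∧ k₂ ≤ 2)
    (hk₃ : 0 ≤ k₃ ∧ k₃ ≤ 2) :
    ternaryWeight A A' B - 4 ≤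
      4 * ((if k = 0 then 1 else 0) - (if k₁ = 0 then 1 else 0) - (if k₂ = 0 then 1 else 0) +
        if k₃ = 0 then 1 else 0) + 2 * ((if A' then 1 else 0) - if A then 1 else 0) ∧
    4 * ((if k = 0 then 1 else 0) - (if k₁ = 0 then 1 else 0) - (if k₂ = 0 then 1 else 0) +
        if k₃ = 0 then 1 else 0) + 2 * ((if A' then 1 else 0) - if A then 1 else 0) ≤
      ternaryWeight A A' B := by
  unfold ternaryWeight
  obtain ⟨hk0, hk2⟩ := hk
  by_cases hA : A <;> by_cases hA' : A' <;> by_cases hB : B <;> by_cases hB' : B' <;>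
    by_cases hC : C <;>
    simp only [hA, hA', hB, hB', hC, if_true, if_false, iff_true, iff_false, not_true_eq_false]
      at h₁ h₂ h₃ ⊢ <;>
    interval_cases k <;> subst h₁ <;> subst h₂ <;> subst h₃ <;> omega

theorem ternaryWeight_mem (A A' B : Prop) [Decidable A] [Decidable A'] [Decidable B] :
    0 ≤ ternaryWeight A A' B ∧ ternaryWeight A A' B ≤ 4 := by
  unfold ternaryWeight
  split_ifs <;> norm_num

/-- The coefficients of a ternary cyclotomic polynomial, together with `0`, lie in an interval of
length `p`. -/
theorem exists_four_mul_coeff_cyclotomic_bounds {p q r : ℕ} (hp : p.Prime) (hq : q.Prime)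
    (hr : r.Prime) (hpq : p ≠ q) (hpr : p ≠ r) (hqr : q ≠ r) :
    ∃ U : ℤ, 0 ≤ U ∧ U ≤ 4 * p ∧ ∀ n, U - 4 * p ≤ 4 * (cyclotomic (p * q * r) ℤ).coeff n ∧
      4 * (cyclotomic (p * q * r) ℤ).coeff n ≤ U := by
  have cpq := (Nat.coprime_primes hp hq).2 hpq
  have cpr := (Nat.coprime_primes hp hr).2 hpr
  have cqr := (Nat.coprime_primes hq hr).2 hqr
  have ipq := Nat.isCoprime_iff_coprime.2 cpq
  have ipr := Nat.isCoprime_iff_coprime.2 cpr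
  have iqr := Nat.isCoprime_iff_coprime.2 cqr
  obtain ⟨Q, Pq, hQ0, hQp, hPq0, hPqq, hQ⟩ :=
    exists_mul_add_mul_eq_mul_add_one cpq.symm hp.one_lt hq.one_lt
  obtain ⟨R, Pr, hR0, hRp, hPr0, hPrr, hR⟩ :=
    exists_mul_add_mul_eq_mul_add_one cpr.symm hp.one_lt hr.one_lt
  obtain ⟨Z, V, hZ0, hZq, hV0, hVr, hZ⟩ :=
    exists_mul_add_mul_eq_mul_add_one cqr.symm hq.one_lt hr.one_lt
  have hp1 := hp.one_lt
  have hq1 := hq.one_lt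
  have hr1 := hr.one_lt
  have hp0 : (0 : ℤ) < p := by omega
  have hq0 : (0 : ℤ) < q := by omega
  have hr0 : (0 : ℤ) < r := by omega
  have hN0 : (0 : ℤ) < p * q * r := by positivity
  zify at hQ hR hZ
  set a : ℤ → ℤ := fun t => t * (R * Q) % p with ha_def
  set b : ℤ → ℤ := fun t => t * (Pq * Z) % q with hb_def
  set c : ℤ → ℤ := fun t => t * (Pr * V) % r with hc_def
  have ha0 : ∀ t, 0 ≤ a t := fun t => Int.emod_nonneg _ hp0.ne'
  have hap : ∀ t, a t < p := fun t => Int.emod_lt_of_pos _ hp0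
  have hb0 : ∀ t, 0 ≤ b t := fun t => Int.emod_nonneg _ hq0.ne'
  have hbq : ∀ t, b t < q := fun t => Int.emod_lt_of_pos _ hq0
  have hc0 : ∀ t, 0 ≤ c t := fun t => Int.emod_nonneg _ hr0.ne'
  have hcr : ∀ t, c t < r := fun t => Int.emod_lt_of_pos _ hr0
  have hexF : ∀ t, ∃ F : ℤ,
      t + F * (p * q * r) = a t * (q * r) + b t * (p * r) + c t * (p * q) := by
    intro t
    have ea : t * (R * Q) % p + p * (t * (R * Q) / p) = t * (R * Q) := Int.emod_add_mul_ediv _ _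
    have eb : t * (Pq * Z) % q + q * (t * (Pq * Z) / q) = t * (Pq * Z) := Int.emod_add_mul_ediv _ _
    have ec : t * (Pr * V) % r + r * (t * (Pr * V) / r) = t * (Pr * V) := Int.emod_add_mul_ediv _ _
    change a t + _ = _ at ea
    change b t + _ = _ at eb
    change c t + _ = _ at ec
    have dp : (p : ℤ) ∣ a t * (q * r) + b t * (p * r) + c t * (p * q) - t :=
      ⟨b t * r + c t * q - t * (R * Q) / p * (q * r) + t * (q - Pq) * (R * r) + t * (r - Pr), by
        linear_combination (q * r : ℤ) * ea + t * (R * r) * hQ + t * hR⟩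
    have dq : (q : ℤ) ∣ a t * (q * r) + b t * (p * r) + c t * (p * q) - t :=
      ⟨a t * r + c t * p - t * (Pq * Z) / q * (p * r) + t * (p - Q) * (Z * r) + t * (r - V), by
        linear_combination (p * r : ℤ) * eb + t * (Z * r) * hQ + t * hZ⟩
    have dr : (r : ℤ) ∣ a t * (q * r) + b t * (p * r) + c t * (p * q) - t :=
      ⟨a t * q + b t * p - t * (Pr * V) / r * (p * q) + t * (p - R) * (V * q) + t * (q - Z), by
        linear_combination (p * q : ℤ) * ec + t * (V * q) * hR + t * hZ⟩
    obtain ⟨F, hF⟩ := (IsCoprime.mul_left ipr iqr).mul_dvd (ipq.mul_dvd dp dq) dr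
    exact ⟨F, by linear_combination -hF⟩
  choose F hF using hexF
  have a_sub_q : ∀ t, a (t - q) = a t - R + if a t < R then (p : ℤ) else 0 := fun t =>
    emod_eq_emod_sub_add_ite (k := -(R * (q - Pq))) hp0 (by omega) (by omega) (by
      linear_combination (-(R : ℤ)) * hQ)
  have c_sub_q : ∀ t, c (t - q) = c t - Pr + if c t < Pr then (r : ℤ) else 0 := fun t =>
    emod_eq_emod_sub_add_ite (k := -(Pr * (q - Z))) hr0 (by omega) (by omega) (by
      linear_combination (-(Pr : ℤ)) * hZ)
  have b_sub_q : ∀ t, b (t - q) = b t := fun t => by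
    change (t - q) * (Pq * Z) % q = t * (Pq * Z) % q
    rw [show (t - q) * (Pq * Z) = t * (Pq * Z) + q * -(Pq * Z : ℤ) by ring,
      Int.add_mul_emod_self_left]
  have a_sub_r : ∀ t, a (t - r) = a t - Q + if a t < Q then (p : ℤ) else 0 := fun t =>
    emod_eq_emod_sub_add_ite (k := -(Q * (r - Pr))) hp0 (by omega) (by omega) (by
      linear_combination (-(Q : ℤ)) * hR)
  have b_sub_r : ∀ t, b (t - r) = b t - Pq + if b t < Pq then (q : ℤ) else 0 := fun t =>
    emod_eq_emod_sub_add_ite (k := -(Pq * (r - V))) hq0 (by omega) (by omega) (by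
      linear_combination (-(Pq : ℤ)) * hZ)
  have c_sub_r : ∀ t, c (t - r) = c t := fun t => by
    change (t - r) * (Pr * V) % r = t * (Pr * V) % r
    rw [show (t - r) * (Pr * V) = t * (Pr * V) + r * -(Pr * V : ℤ) by ring,
      Int.add_mul_emod_self_left]
  have F_sub_q : ∀ t, F (t - q) = F t - 1 + (if a t < R then 1 else 0) +
      if c t < Pr then 1 else 0 := by
    intro t
    have h1 := hF t
    have h2 := hF (t - q)
    rw [a_sub_q, b_sub_q, c_sub_q] at h2
    apply mul_right_cancel₀ hN0.ne'
    split_ifs at h2 ⊢ <;> linear_combination h2 - h1 - (q : ℤ) * hR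
  have F_sub_r : ∀ t, F (t - r) = F t - 1 + (if a t < Q then 1 else 0) +
      if b t < Pq then 1 else 0 := by
    intro t
    have h1 := hF t
    have h2 := hF (t - r)
    rw [a_sub_r, b_sub_r, c_sub_r] at h2
    apply mul_right_cancel₀ hN0.ne'
    split_ifs at h2 ⊢ <;> linear_combination h2 - h1 - (r : ℤ) * hQ
  have sum_nonneg : ∀ t, 0 ≤ a t * (q * r) + b t * (p * r) + c t * (p * q) := fun t => by
    have := ha0 t
    have := hb0 t
    have := hc0 t
    positivity
  have F_mem : ∀ t : ℤ, -(p + q + r : ℤ) < t → t < p * q * r → 0 ≤ F t ∧ F t ≤ 2 := by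
    intro t h1 h2
    have h3 := hF t
    have h4 := sum_nonneg t
    have h5 : a t * (q * r) ≤ (p - 1) * (q * r) :=
      mul_le_mul_of_nonneg_right (by have := hap t; omega) (by positivity)
    have h6 : b t * (p * r) ≤ (q - 1) * (p * r) :=
      mul_le_mul_of_nonneg_right (by have := hbq t; omega) (by positivity)
    have h7 : c t * (p * q) ≤ (r - 1) * (p * q) :=
      mul_le_mul_of_nonneg_right (by have := hcr t; omega) (by positivity)
    have h8 : (p + q + r : ℤ) ≤ p * q + q * r + p * r := by nlinarith
    constructor
    · by_contra! hlt
      have : F t * (p * q * r) ≤ -1 * (p * q * r) :=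
        mul_le_mul_of_nonneg_right (by omega) hN0.le
      linarith
    · by_contra! hlt
      have : 3 * (p * q * r) ≤ F t * (p * q * r) :=
        mul_le_mul_of_nonneg_right (by omega) hN0.le
      linarith
  set w : ℤ → ℤ := fun t => if F t = 0 then 1 else 0 with hw_def
  have hw : ∀ n : ℕ, w n = (tripleGeom p q r).coeff n := fun n =>
    (coeff_tripleGeom_eq_ite ipq ipr iqr (ha0 _) (hap _) (hb0 _) (hbq _) (hc0 _) (hcr _)
      (hF n)).symm
  have hneg : ∀ t < 0, w t = 0 := fun t ht => if_neg fun h0 => by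
    have h1 := hF t
    have h2 := sum_nonneg t
    rw [h0] at h1
    linarith
  have hk : IsCoprime (p : ℤ) (R * Q) :=
    IsCoprime.mul_right ⟨Pr - r, r, by linear_combination hR⟩
      ⟨Pq - q, q, by linear_combination hQ⟩
  set u : ℤ → ℤ := fun j =>
    ternaryWeight (j < R) (j - Q + (if j < Q then (p : ℤ) else 0) < R) (j < Q) with hu_def
  have hU0 : 0 ≤ ∑ j ∈ Finset.range p, u j :=
    Finset.sum_nonneg fun j _ => (ternaryWeight_mem _ _ _).1
  have hU4 : ∑ j ∈ Finset.range p, u j ≤ 4 * p := by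
    refine (Finset.sum_le_sum fun j _ => (ternaryWeight_mem _ _ _).2).trans_eq ?_
    rw [Finset.sum_const, Finset.card_range, nsmul_eq_mul, mul_comm]
  refine ⟨∑ j ∈ Finset.range p, u j, hU0, hU4, fun n => ?_⟩
  have hU : ∑ i ∈ Finset.range p, u (a (n - i)) = ∑ j ∈ Finset.range p, u j :=
    sum_range_sub_mul_emod hp.pos hk n u
  by_cases hn : n < p * q * r
  swap
  · have h0 : (cyclotomic (p * q * r) ℤ).coeff n = 0 := by
      apply coeff_eq_zero_of_natDegree_lt
      rw [natDegree_cyclotomic]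
      refine (Nat.totient_lt _ ?_).trans_le (not_lt.1 hn)
      nlinarith [Nat.mul_le_mul hp.two_le hq.two_le]
    rw [h0]
    constructor <;> linarith
  have hD : ∑ i ∈ Finset.range p, 2 * ((if a (n - i - r) < R then (1 : ℤ) else 0) -
      if a (n - i) < R then 1 else 0) = 0 := by
    have e1 := sum_range_sub_mul_emod hp.pos hk n fun j => if j < R then 1 else 0
    have e2 := sum_range_sub_mul_emod hp.pos hk (n - r) fun j => if j < R then 1 else 0
    rw [← Finset.mul_sum, Finset.sum_sub_distrib]
    simp only [sub_right_comm (n : ℤ) _ (r : ℤ)]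
    rw [mul_eq_zero]
    exact Or.inr (sub_eq_zero.2 (e2.trans e1.symm))
  have hcoeff := coeff_eq_sum_of_mul_eq hw hneg hn (cyclotomic_three_primes_mul_sq hp hq hr
    (fun h => hpq ((Nat.prime_dvd_prime_iff_eq hq hp).1 h).symm)
    (fun h => (hr.dvd_mul.1 h).elim
      (fun h => hpr ((Nat.prime_dvd_prime_iff_eq hr hp).1 h).symm)
      (fun h => hqr ((Nat.prime_dvd_prime_iff_eq hr hq).1 h).symm)))
  have h4 : 4 * (cyclotomic (p * q * r) ℤ).coeff n = ∑ i ∈ Finset.range p,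
      (4 * (w (n - i) - w (n - i - q) - w (n - i - r) + w (n - i - r - q)) +
        2 * ((if a (n - i - r) < R then (1 : ℤ) else 0) - if a (n - i) < R then 1 else 0)) := by
    rw [Finset.sum_add_distrib, hD, add_zero, ← Finset.mul_sum, hcoeff]
  have hterm : ∀ i ∈ Finset.range p, u (a (n - i)) - 4 ≤
      4 * (w (n - i) - w (n - i - q) - w (n - i - r) + w (n - i - r - q)) +
        2 * ((if a (n - i - r) < R then (1 : ℤ) else 0) - if a (n - i) < R then 1 else 0) ∧
      4 * (w (n - i) - w (n - i - q) - w (n - i - r) + w (n - i - r - q)) +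
        2 * ((if a (n - i - r) < R then (1 : ℤ) else 0) - if a (n - i) < R then 1 else 0) ≤
      u (a (n - i)) := by
    intro i hi
    have hi := Finset.mem_range.1 hi
    have hnN : (n : ℤ) < p * q * r := by exact_mod_cast hn
    have hF3 := F_sub_q (n - i - r)
    rw [c_sub_r] at hF3
    simp only [hw_def, hu_def, ← a_sub_r]
    exact ternaryWeight_bounds (F_sub_q _) (F_sub_r _) hF3 (F_mem _ (by omega) (by omega))
      (F_mem _ (by omega) (by omega)) (F_mem _ (by omega) (by omega))
      (F_mem _ (by omega) (by omega))
  rw [h4]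
  constructor
  · refine le_trans (le_of_eq ?_) (Finset.sum_le_sum fun i hi => (hterm i hi).1)
    rw [Finset.sum_sub_distrib, hU, Finset.sum_const, Finset.card_range, nsmul_eq_mul, mul_comm]
  · exact (Finset.sum_le_sum fun i hi => (hterm i hi).2).trans_eq hU

theorem A_le_of_abs_coeff_le {n : ℕ} {M : ℝ}
    (h : ∀ m, |((cyclotomic n ℤ).coeff m : ℝ)| ≤ M) : (A n : ℝ) ≤ M := by
  have hM : 0 ≤ M := (abs_nonneg _).trans (h 0)
  rw [← Nat.le_floor_iff hM]
  refine Finset.sup_le fun m _ => (Nat.le_floor_iff hM).2 ?_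
  rw [Nat.cast_natAbs, Int.cast_abs]
  exact h m

/-- With `x q + y p = p q + 1`, the number `2 x y - 1` bounds the sum of the absolute values of the
coefficients of `Φ_{pq}`. -/
theorem abs_coeff_cyclotomic_four_primes_le {p q r s x y : ℕ} (hp : p.Prime) (hq : q.Prime)
    (hr : r.Prime) (hs : s.Prime) (hpq : p < q) (hqr : q < r) (hrs : r < s) (hxp : x < p)
    (hyq : y < q) (hxy : x * q + y * p = p * q + 1) (m : ℕ) :
    |(cyclotomic (p * q * r * s) ℤ).coeff m| ≤ (2 * (x * y) - 1 : ℤ) * p ^ 2 := by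
  have hqp : ¬ q ∣ p := Nat.not_dvd_of_pos_of_lt hp.pos hpq
  have hrpq : ¬ r ∣ p * q := fun h => (hr.dvd_mul.1 h).elim
    (Nat.not_dvd_of_pos_of_lt hp.pos (hpq.trans hqr)) (Nat.not_dvd_of_pos_of_lt hq.pos hqr)
  have hspqr : ¬ s ∣ p * q * r := fun h => (hs.dvd_mul.1 h).elim
    (fun h => (hs.dvd_mul.1 h).elim
      (Nat.not_dvd_of_pos_of_lt hp.pos (hpq.trans (hqr.trans hrs)))
      (Nat.not_dvd_of_pos_of_lt hq.pos (hqr.trans hrs)))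
    (Nat.not_dvd_of_pos_of_lt hr.pos hrs)
  have hN0 : 0 < p * q * r := mul_pos (mul_pos hp.pos hq.pos) hr.pos
  have hdeg : (cyclotomic (p * q * r) ℤ).natDegree < p * q * r := by
    rw [natDegree_cyclotomic]
    exact Nat.totient_lt _ (by nlinarith [Nat.mul_le_mul hp.two_le hq.two_le, hr.two_le])
  obtain ⟨U, hU0, hU4, hU⟩ := exists_four_mul_coeff_cyclotomic_bounds hp hq hr hpq.ne
    (hpq.trans hqr).ne hqr.ne
  set E : ℤ[X] := (∑ k ∈ Finset.range (m + 1), (X ^ (p * q * r)) ^ k) *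
    expand ℤ s (cyclotomic (p * q * r) ℤ) with hE_def
  have hE : ∀ t, U - 4 * p ≤ 4 * E.coeff t ∧ 4 * E.coeff t ≤ U := by
    intro t
    obtain h | ⟨j, h⟩ := coeff_expand_mul_geom_sum hs.pos hN0
      ((hs.coprime_iff_not_dvd.2 hspqr).symm) hdeg (m + 1) t
    · rw [h]; constructor <;> linarith
    · rw [h]; exact hU j
  have hD : ∀ t, |((1 - X ^ (q * r)) * E).coeff t| ≤ (p : ℤ) := by
    intro t
    rw [sub_mul, one_mul, coeff_sub, coeff_X_pow_mul', abs_le]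
    have h1 := hE t
    split_ifs with h
    · have h2 := hE (t - q * r)
      constructor <;> linarith
    · constructor <;> linarith
  have hP : ∀ t, |(expand ℤ r (cyclotomic p ℤ) * ((1 - X ^ (q * r)) * E)).coeff t| ≤ (p * p : ℤ) := by
    have := Fact.mk hp
    have hexp : expand ℤ r (cyclotomic p ℤ) = ∑ i ∈ Finset.range p, (X ^ r) ^ i := by
      simp [cyclotomic_prime]
    rw [hexp]
    exact abs_coeff_geom_sum_mul_le hD r p
  set D := expand ℤ r (cyclotomic p ℤ) * ((1 - X ^ (q * r)) * E) with hD_def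
  have hkey : cyclotomic (p * q * r * s) ℤ * (1 - X ^ (p * q * r * (m + 1))) =
      cyclotomic (p * q) ℤ * D := by
    have h1 := cyclotomic_three_primes_mul hp hq hr hqp hrpq
    have h2 := cyclotomic_mul_prime_mul_cyclotomic hs hspqr
    have h3 := geom_sum_mul (X ^ (p * q * r) : ℤ[X]) (m + 1)
    rw [hD_def, hE_def, ← h2, pow_mul, ← neg_sub, ← h3, ← h1]
    ring
  have hcoeff : (cyclotomic (p * q * r * s) ℤ).coeff m = (cyclotomic (p * q) ℤ * D).coeff m := by
    rw [← hkey, mul_sub, mul_one, coeff_sub, mul_comm _ (X ^ _), coeff_X_pow_mul', if_neg, sub_zero]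
    nlinarith
  rw [hcoeff, cyclotomic_two_primes_eq hp hq hqp hxp hyq hxy, sub_mul, coeff_sub, mul_assoc,
    mul_assoc (X ^ 1), mul_assoc (∑ i ∈ Finset.range (q - y), _), coeff_X_pow_mul']
  have h1 := abs_coeff_geom_sum_mul_le (abs_coeff_geom_sum_mul_le hP q x) p y m
  have h2 : ∀ t, _ := abs_coeff_geom_sum_mul_le (abs_coeff_geom_sum_mul_le hP q (p - x)) p (q - y)
  have h3 : ∀ t, |if 1 ≤ t then ((∑ i ∈ Finset.range (q - y), (X ^ p) ^ i) *
      ((∑ j ∈ Finset.range (p - x), (X ^ q) ^ j) * D)).coeff (t - 1) else 0| ≤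
      ((q - y : ℕ) : ℤ) * (((p - x : ℕ) : ℤ) * (p * p)) := by
    intro t
    split_ifs
    · exact h2 _
    · rw [abs_zero]; positivity
  refine (abs_sub _ _).trans ((add_le_add h1 (h3 m)).trans_eq ?_)
  rw [Nat.cast_sub hxp.le, Nat.cast_sub hyq.le]
  zify at hxy
  linear_combination (-(p : ℤ) ^ 2) * hxy

/-- **(Bzdęga, bound (5)).** For odd primes `p < q < r < s`, `A (pqrs) ≤ (3/4)·p³q`. -/
theorem height_cyclotomic_stmt9 (p q r s : ℕ)
    (hp : p.Prime) (hq : q.Prime) (hr : r.Prime) (hs : s.Prime)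
    (hop : Odd p) (hoq : Odd q) (hor : Odd r) (hos : Odd s)
    (hpq : p < q) (hqr : q < r) (hrs : r < s) :
    (A (p * q * r * s) : ℝ) ≤ (3 / 4) * (p : ℝ) ^ 3 * q := by
  obtain ⟨x, y, -, hxp, -, hyq, hxy⟩ := exists_mul_add_mul_eq_mul_add_one
    ((Nat.coprime_primes hq hp).2 hpq.ne') hp.one_lt hq.one_lt
  refine A_le_of_abs_coeff_le fun m => ?_
  have h : |((cyclotomic (p * q * r * s) ℤ).coeff m : ℝ)| ≤ (2 * (x * y) - 1) * p ^ 2 := by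
    exact_mod_cast abs_coeff_cyclotomic_four_primes_le hp hq hr hs hpq hqr hrs hxp hyq hxy m
  have hp2 : (2 : ℝ) ≤ p := by exact_mod_cast hp.two_le
  have hq2 : (2 : ℝ) ≤ q := by exact_mod_cast hq.two_le
  have hpq4 : (4 : ℝ) ≤ p * q := by nlinarith
  have hxy' : (x * q + y * p : ℝ) = p * q + 1 := by exact_mod_cast hxy
  have hsq : (4 * (p * q) * (x * y) : ℝ) ≤ (p * q + 1) ^ 2 := by
    rw [← hxy']
    linarith [sq_nonneg (x * q - y * p : ℝ)]
  have hxy2 : (2 * (x * y) - 1 : ℝ) ≤ 3 / 4 * (p * q) := by nlinarith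
  calc _ ≤ (2 * (x * y) - 1 : ℝ) * p ^ 2 := h
    _ ≤ 3 / 4 * (p * q) * p ^ 2 := by gcongr
    _ = _ := by ring
end

section
/- For all odd primes p < q < r < s < t, the height of the cyclotomic polynomial Φ_{pqrst} is at most (135/512)·p⁷q³r. -/
open Polynomial

/-- The length of `f` with respect to a weight `w`, that is `∑ j, |f_j| * w j`. -/
noncomputable def wlen (w : ℕ → ℕ) (f : ℤ[X]) : ℕ :=
  ∑ j ∈ f.support, (f.coeff j).natAbs * w j

/-- The length of `f`, that is the sum of the absolute values of its coefficients. -/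
noncomputable abbrev len (f : ℤ[X]) : ℕ := wlen (fun _ => 1) f

lemma wlen_eq_sum {w : ℕ → ℕ} {f : ℤ[X]} {s : Finset ℕ} (h : f.support ⊆ s) :
    wlen w f = ∑ j ∈ s, (f.coeff j).natAbs * w j := by
  refine Finset.sum_subset h fun j _ hj => ?_
  simp [notMem_support_iff.mp hj]

lemma wlen_add_le (w : ℕ → ℕ) (f g : ℤ[X]) : wlen w (f + g) ≤ wlen w f + wlen w g := by
  rw [wlen_eq_sum (w := w) support_add, wlen_eq_sum (w := w) Finset.subset_union_left,
    wlen_eq_sum (w := w) (f := g) Finset.subset_union_right, ← Finset.sum_add_distrib]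
  refine Finset.sum_le_sum fun j _ => ?_
  rw [← add_mul, coeff_add]
  exact Nat.mul_le_mul_right _ (Int.natAbs_add_le _ _)

lemma wlen_neg (w : ℕ → ℕ) (f : ℤ[X]) : wlen w (-f) = wlen w f := by
  simp [wlen]

lemma wlen_sub_le (w : ℕ → ℕ) (f g : ℤ[X]) : wlen w (f - g) ≤ wlen w f + wlen w g := by
  rw [sub_eq_add_neg, ← wlen_neg w g]
  exact wlen_add_le w f (-g)

lemma wlen_sum_le {ι : Type*} (w : ℕ → ℕ) (s : Finset ι) (f : ι → ℤ[X]) :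
    wlen w (∑ i ∈ s, f i) ≤ ∑ i ∈ s, wlen w (f i) := by
  classical
  induction s using Finset.induction_on with
  | empty => simp [wlen]
  | insert a s ha ih =>
    rw [Finset.sum_insert ha, Finset.sum_insert ha]
    exact (wlen_add_le _ _ _).trans (by gcongr)

lemma wlen_monomial (w : ℕ → ℕ) (n : ℕ) (c : ℤ) : wlen w (monomial n c) = c.natAbs * w n := by
  rw [wlen_eq_sum (support_monomial_subset n c)]
  simp

lemma wlen_X_pow (w : ℕ → ℕ) (n : ℕ) : wlen w (X ^ n) = w n := by
  rw [X_pow_eq_monomial, wlen_monomial]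
  simp

lemma wlen_le_wlen {w v : ℕ → ℕ} (h : ∀ j, w j ≤ v j) (f : ℤ[X]) : wlen w f ≤ wlen v f :=
  Finset.sum_le_sum fun j _ => Nat.mul_le_mul_left _ (h j)

lemma wlen_congr {w : ℕ → ℕ} {f g : ℤ[X]}
    (h : ∀ j, w j ≠ 0 → (f.coeff j).natAbs = (g.coeff j).natAbs) : wlen w f = wlen w g := by
  rw [wlen_eq_sum (w := w) (Finset.subset_union_left (s₂ := g.support)),
    wlen_eq_sum (w := w) (Finset.subset_union_right (s₁ := f.support))]
  refine Finset.sum_congr rfl fun j _ => ?_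
  by_cases hj : w j = 0
  · simp [hj]
  · rw [h j hj]

lemma wlen_linear (c d : ℕ) (w v : ℕ → ℕ) (f : ℤ[X]) :
    wlen (fun j => c * w j + d * v j) f = c * wlen w f + d * wlen v f := by
  simp only [wlen, Finset.mul_sum, ← Finset.sum_add_distrib]
  exact Finset.sum_congr rfl fun j _ => by ring

lemma wlen_mul_le (w : ℕ → ℕ) (f g : ℤ[X]) :
    wlen w (f * g) ≤ wlen (fun i => wlen (fun j => w (i + j)) g) f := by
  rw [mul_eq_sum_sum]
  refine (wlen_sum_le _ _ _).trans (Finset.sum_le_sum fun i _ => ?_)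
  rw [sum_def]
  refine (wlen_sum_le _ _ _).trans (le_of_eq ?_)
  simp only [wlen_monomial, Int.natAbs_mul]
  rw [wlen, Finset.mul_sum]
  exact Finset.sum_congr rfl fun j _ => by ring

lemma wlen_mul_le_of_antitone {w : ℕ → ℕ} (hw : Antitone w) (f g : ℤ[X]) :
    wlen w (f * g) ≤ wlen w f * len g := by
  refine (wlen_mul_le w f g).trans ?_
  have h : ∀ i, wlen (fun j => w (i + j)) g ≤ len g * w i + 0 * w i := fun i => by
    rw [len, wlen, wlen, zero_mul, add_zero, Finset.sum_mul]
    refine Finset.sum_le_sum fun j _ => ?_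
    rw [mul_one]
    exact Nat.mul_le_mul_left _ (hw (Nat.le_add_right i j))
  refine (wlen_le_wlen h f).trans (le_of_eq ?_)
  rw [wlen_linear]
  ring

lemma len_mul_le (f g : ℤ[X]) : len (f * g) ≤ len f * len g :=
  wlen_mul_le_of_antitone antitone_const f g

lemma wlen_expand_le (w : ℕ → ℕ) (t : ℕ) (f : ℤ[X]) :
    wlen w (expand ℤ t f) ≤ wlen (fun j => w (t * j)) f := by
  rw [expand_eq_sum, sum_def]
  refine (wlen_sum_le _ _ _).trans (Finset.sum_le_sum fun j _ => ?_)
  rw [← pow_mul, C_mul_X_pow_eq_monomial, wlen_monomial]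

lemma len_expand_le (t : ℕ) (f : ℤ[X]) : len (expand ℤ t f) ≤ len f :=
  wlen_expand_le _ t f

lemma polyHeight_le {f : ℤ[X]} {B : ℕ} (h : ∀ n, (f.coeff n).natAbs ≤ B) : polyHeight f ≤ B :=
  Finset.sup_le fun n _ => h n

lemma natAbs_coeff_le_polyHeight (f : ℤ[X]) (n : ℕ) : (f.coeff n).natAbs ≤ polyHeight f := by
  by_cases hn : n ∈ f.support
  · exact Finset.le_sup (f := fun m => (f.coeff m).natAbs) hn
  · simp [notMem_support_iff.mp hn]

lemma polyHeight_mul_le (f g : ℤ[X]) : polyHeight (f * g) ≤ polyHeight f * len g := by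
  refine polyHeight_le fun n => ?_
  rw [mul_comm f g, coeff_mul, Finset.Nat.sum_antidiagonal_eq_sum_range_succ_mk]
  refine (Int.natAbs_sum_le _ _).trans ?_
  have h1 : ∀ i ∈ Finset.range n.succ, (g.coeff i * f.coeff (n - i)).natAbs ≤
      (g.coeff i).natAbs * 1 * polyHeight f := fun i _ => by
    rw [Int.natAbs_mul, mul_one]
    exact Nat.mul_le_mul_left _ (natAbs_coeff_le_polyHeight f _)
  refine (Finset.sum_le_sum h1).trans ?_
  rw [← Finset.sum_mul, mul_comm, len,
    wlen_eq_sum (Finset.subset_union_left (s₂ := Finset.range n.succ))]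
  exact Nat.mul_le_mul_left _ (Finset.sum_le_sum_of_subset Finset.subset_union_right)

lemma coeff_sum_X_pow {ι : Type*} {s : Finset ι} {e : ι → ℕ} (he : Set.InjOn e s) (n : ℕ) :
    (∑ i ∈ s, X ^ e i : ℤ[X]).coeff n = 0 ∨
      (∑ i ∈ s, X ^ e i : ℤ[X]).coeff n = 1 ∧ ∃ i ∈ s, e i = n := by
  classical
  simp only [finsetSum_coeff, coeff_X_pow]
  by_cases h : ∃ i ∈ s, e i = n
  · obtain ⟨i, hi, rfl⟩ := h
    refine Or.inr ⟨?_, i, hi, rfl⟩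
    rw [Finset.sum_eq_single_of_mem i hi fun j hj hji => if_neg fun h => hji (he hj hi h.symm)]
    simp
  · refine Or.inl (Finset.sum_eq_zero fun i hi => if_neg fun h' => h ⟨i, hi, h'.symm⟩)

lemma polyHeight_expand_mul_geom_le {m t : ℕ} (f : ℤ[X]) (K : ℕ) (hf : f.natDegree < m)
    (hmt : t.Coprime m) :
    polyHeight (expand ℤ t f * ∑ k ∈ Finset.range K, X ^ (m * k)) ≤ polyHeight f := by
  refine polyHeight_le fun n => ?_
  have key : (expand ℤ t f * ∑ k ∈ Finset.range K, X ^ (m * k)) =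
      ∑ x ∈ f.support ×ˢ Finset.range K, monomial (t * x.1 + m * x.2) (f.coeff x.1) := by
    rw [Finset.sum_product, expand_eq_sum, sum_def, Finset.sum_mul]
    refine Finset.sum_congr rfl fun i _ => ?_
    rw [Finset.mul_sum]
    refine Finset.sum_congr rfl fun k _ => ?_
    rw [← C_mul_X_pow_eq_monomial]
    ring
  have inj : ∀ x ∈ f.support ×ˢ Finset.range K, ∀ y ∈ f.support ×ˢ Finset.range K,
      t * x.1 + m * x.2 = t * y.1 + m * y.2 → x = y := by
    intro x hx y hy h
    have hx1 := (le_natDegree_of_mem_supp _ (Finset.mem_product.mp hx).1).trans_lt hf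
    have hy1 := (le_natDegree_of_mem_supp _ (Finset.mem_product.mp hy).1).trans_lt hf
    have h1 : t * x.1 ≡ t * y.1 [MOD m] := by
      have : t * x.1 + m * x.2 ≡ t * y.1 + m * y.2 [MOD m] := by rw [h]
      simpa [Nat.ModEq] using this
    have h2 : x.1 = y.1 :=
      (Nat.ModEq.cancel_left_of_coprime hmt.symm h1).eq_of_lt_of_lt hx1 hy1
    refine Prod.ext h2 ?_
    rw [h2] at h
    exact Nat.eq_of_mul_eq_mul_left (by lia) (Nat.add_left_cancel h)
  simp only [key, finsetSum_coeff, coeff_monomial]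
  by_cases h : ∃ x ∈ f.support ×ˢ Finset.range K, t * x.1 + m * x.2 = n
  · obtain ⟨x, hx, rfl⟩ := h
    rw [Finset.sum_eq_single_of_mem x hx fun y hy hyx => if_neg fun h => hyx (inj y hy x hx h)]
    simpa using natAbs_coeff_le_polyHeight f x.1
  · rw [Finset.sum_eq_zero fun x hx => if_neg fun h' => h ⟨x, hx, h'⟩]
    simp

lemma cyclotomic_reverse {n : ℕ} (hn : 1 < n) :
    (cyclotomic n ℤ).reverse = cyclotomic n ℤ := by
  have hpos : 0 < n := by lia
  have hlead : (cyclotomic n ℤ).reverse.Monic := by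
    rw [Monic, reverse_leadingCoeff, trailingCoeff,
      natTrailingDegree_eq_zero.mpr (Or.inr (by simp [cyclotomic_coeff_zero ℤ hn])),
      cyclotomic_coeff_zero ℤ hn]
  refine eq_of_monic_of_dvd_of_natDegree_le (cyclotomic.monic n ℤ) hlead ?_
    (reverse_natDegree_le _)
  have hζ := Complex.isPrimitiveRoot_exp n hpos.ne'
  set ζ := Complex.exp (2 * Real.pi * Complex.I / n)
  have hζ0 : ζ ≠ 0 := hζ.ne_zero hpos.ne'
  rw [cyclotomic_eq_minpoly hζ.inv hpos]
  refine minpoly.isIntegrallyClosed_dvd (hζ.inv.isIntegral hpos) ?_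
  let _ : Invertible ζ := invertibleOfNonzero hζ0
  have h := (eval₂_reverse_eq_zero_iff (Int.castRingHom ℂ) ζ (cyclotomic n ℤ)).mpr (by
    rw [← eval_map, map_cyclotomic]
    exact hζ.isRoot_cyclotomic hpos)
  rw [invOf_eq_inv, cyclotomic_eq_minpoly hζ.inv hpos] at h
  exact h

lemma coeff_cyclotomic_symm {n j : ℕ} (hn : 1 < n) (hj : j ≤ n.totient) :
    (cyclotomic n ℤ).coeff (n.totient - j) = (cyclotomic n ℤ).coeff j := by
  conv_rhs => rw [← cyclotomic_reverse hn, coeff_reverse, natDegree_cyclotomic, revAt_le hj]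

lemma support_cyclotomic_subset (n : ℕ) :
    (cyclotomic n ℤ).support ⊆ Finset.range (n.totient + 1) := fun j hj => by
  have := le_natDegree_of_mem_supp _ hj
  rw [natDegree_cyclotomic] at this
  exact Finset.mem_range_succ_iff.mpr this

lemma sum_upper_half_cyclotomic {n h : ℕ} (hn : 1 < n) (hh : n.totient = 2 * h) :
    ∑ j ∈ Finset.range h, ((cyclotomic n ℤ).coeff (h + 1 + j)).natAbs =
      ∑ j ∈ Finset.range h, ((cyclotomic n ℤ).coeff j).natAbs := by
  rw [← Finset.sum_range_reflect (fun j => ((cyclotomic n ℤ).coeff j).natAbs)]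
  refine Finset.sum_congr rfl fun j hj => ?_
  have hj := Finset.mem_range.mp hj
  rw [← coeff_cyclotomic_symm hn (show h - 1 - j ≤ n.totient by lia)]
  congr 2
  lia

lemma len_cyclotomic_eq {n h : ℕ} (hn : 1 < n) (hh : n.totient = 2 * h) :
    len (cyclotomic n ℤ) = 2 * ∑ j ∈ Finset.range h, ((cyclotomic n ℤ).coeff j).natAbs +
      ((cyclotomic n ℤ).coeff h).natAbs := by
  rw [len, wlen_eq_sum (support_cyclotomic_subset n), hh,
    show 2 * h + 1 = (h + 1) + h by ring, Finset.sum_range_add, Finset.sum_range_succ]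
  simp only [mul_one]
  rw [sum_upper_half_cyclotomic hn hh]
  ring

lemma len_cyclotomic_le {n h : ℕ} (hn : 1 < n) (hh : n.totient = 2 * h) :
    len (cyclotomic n ℤ) ≤ 2 * wlen (fun j => if j ≤ h then 1 else 0) (cyclotomic n ℤ) := by
  have h1 : ∑ j ∈ Finset.range (h + 1), ((cyclotomic n ℤ).coeff j).natAbs ≤
      wlen (fun j => if j ≤ h then 1 else 0) (cyclotomic n ℤ) := by
    rw [wlen_eq_sum (Finset.subset_union_left (s₂ := Finset.range (h + 1)))]
    refine le_trans (Finset.sum_le_sum fun j hj => ?_)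
      (Finset.sum_le_sum_of_subset Finset.subset_union_right)
    rw [if_pos (Finset.mem_range_succ_iff.mp hj), mul_one]
  rw [Finset.sum_range_succ] at h1
  rw [len_cyclotomic_eq hn hh]
  lia

lemma two_mul_wlen_cyclotomic_le_len {n h : ℕ} (hn : 1 < n) (hh : n.totient = 2 * h) :
    2 * wlen (fun j => if j < h then 1 else 0) (cyclotomic n ℤ) ≤ len (cyclotomic n ℤ) := by
  have h1 : wlen (fun j => if j < h then 1 else 0) (cyclotomic n ℤ) =
      ∑ j ∈ Finset.range h, ((cyclotomic n ℤ).coeff j).natAbs := by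
    rw [wlen_eq_sum (support_cyclotomic_subset n), hh]
    simp only [mul_ite, mul_one, mul_zero]
    rw [← Finset.sum_filter]
    congr 1
    ext j
    simp
    lia
  rw [len_cyclotomic_eq hn hh, h1]
  lia

/-- If `Ψ * Φ_m = X ^ m - 1`, then `Φ_{mt} * (X ^ (m t) - 1)` factors through `Ψ`. -/
lemma cyclotomic_mul_prime_mul_X_pow_sub_one {m t : ℕ} (ht : t.Prime) (htm : ¬t ∣ m) {Ψ : ℤ[X]}
    (hΨ : Ψ * cyclotomic m ℤ = X ^ m - 1) :
    cyclotomic (m * t) ℤ * (X ^ (m * t) - 1) =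
      expand ℤ t (cyclotomic m ℤ) * (∑ k ∈ Finset.range t, X ^ (m * k)) * Ψ := by
  have h1 : (∑ k ∈ Finset.range t, X ^ (m * k)) * (X ^ m - 1) = (X ^ (m * t) - 1 : ℤ[X]) := by
    simp only [pow_mul]
    exact geom_sum_mul _ _
  rw [cyclotomic_expand_eq_cyclotomic_mul ht htm, ← h1, ← hΨ]
  ring

lemma exists_mul_cyclotomic_mul_prime {m t : ℕ} (ht : t.Prime) (htm : ¬t ∣ m) {Ψ : ℤ[X]}
    (hΨ : Ψ * cyclotomic m ℤ = X ^ m - 1) :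
    (cyclotomic m ℤ * expand ℤ t Ψ) * cyclotomic (m * t) ℤ = X ^ (m * t) - 1 := by
  have h := congrArg (expand ℤ t) hΨ
  rw [map_mul, cyclotomic_expand_eq_cyclotomic_mul ht htm] at h
  simp only [map_sub, map_pow, expand_X, map_one] at h
  rw [mul_comm m t, pow_mul, ← h, mul_comm m t]
  ring

lemma natAbs_coeff_mul_X_pow_sub_one {f : ℤ[X]} {m n : ℕ} (hn : n < m) :
    ((f * (X ^ m - 1)).coeff n).natAbs = (f.coeff n).natAbs := by
  rw [mul_sub, mul_one, coeff_sub, coeff_mul_X_pow', if_neg (by lia), zero_sub, Int.natAbs_neg]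

lemma A_le_of_mul_X_pow_sub_one {n B : ℕ} (hn : 1 < n)
    (h : polyHeight (cyclotomic n ℤ * (X ^ n - 1)) ≤ B) : A n ≤ B := by
  refine polyHeight_le fun j => ?_
  by_cases hj : j < n
  · rw [← natAbs_coeff_mul_X_pow_sub_one hj]
    exact (natAbs_coeff_le_polyHeight _ j).trans h
  · rw [coeff_eq_zero_of_natDegree_lt]
    · simp
    · rw [natDegree_cyclotomic]
      have := n.totient_lt hn
      lia

lemma A_mul_prime_le {m t : ℕ} (hm : 1 < m) (ht : t.Prime) (htm : ¬t ∣ m) {Ψ : ℤ[X]}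
    (hΨ : Ψ * cyclotomic m ℤ = X ^ m - 1) : A (m * t) ≤ A m * len Ψ := by
  refine A_le_of_mul_X_pow_sub_one (Nat.one_lt_mul_iff.mpr ⟨by lia, ht.pos, Or.inl hm⟩) ?_
  rw [cyclotomic_mul_prime_mul_X_pow_sub_one ht htm hΨ]
  refine (polyHeight_mul_le _ _).trans (Nat.mul_le_mul_right _ ?_)
  refine polyHeight_expand_mul_geom_le _ _ ?_ (ht.coprime_iff_not_dvd.mpr htm)
  rw [natDegree_cyclotomic]
  exact m.totient_lt hm

lemma exists_nat_mul_add_mul {p q : ℕ} (hp : 1 < p) (hq : 1 < q) (hpq : p.Coprime q) :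
    ∃ a b : ℕ, a ≤ q ∧ b ≤ p ∧ a * p + b * q = p * q + 1 := by
  obtain ⟨a, ha, hmod⟩ := Nat.exists_mul_mod_eq_one_of_coprime hpq hq
  have h1 := Nat.div_add_mod (p * a) q
  rw [hmod] at h1
  have h2 : p * a / q < p := Nat.div_lt_of_lt_mul (by nlinarith)
  refine ⟨a, p - p * a / q, ha.le, Nat.sub_le _ _, ?_⟩
  rw [Nat.sub_mul]
  have : p * a / q * q ≤ p * q := Nat.mul_le_mul_right _ h2.le
  nlinarith [Nat.sub_add_cancel this]

/-- The box representation of `Φ_{pq}`. -/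
lemma cyclotomic_prime_mul_prime {p q a b : ℕ} (hp : p.Prime) (hq : q.Prime) (hpq : p ≠ q)
    (ha : a ≤ q) (hb : b ≤ p) (hab : a * p + b * q = p * q + 1) :
    cyclotomic (p * q) ℤ =
      ∑ x ∈ Finset.range a ×ˢ Finset.range b, X ^ (x.1 * p + x.2 * q) -
        ∑ x ∈ Finset.range (q - a) ×ˢ Finset.range (p - b), X ^ (1 + x.1 * p + x.2 * q) := by
  have hbox : ∀ m n : ℕ, (∑ x ∈ Finset.range m ×ˢ Finset.range n,
      (X : ℤ[X]) ^ (x.1 * p + x.2 * q)) * ((X ^ p - 1) * (X ^ q - 1)) =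
        (X ^ (m * p) - 1) * (X ^ (n * q) - 1) := fun m n => by
    rw [Finset.sum_product]
    simp only [pow_add, ← Finset.mul_sum]
    rw [← Finset.sum_mul, mul_mul_mul_comm]
    simp only [mul_comm _ p, mul_comm _ q, pow_mul]
    rw [geom_sum_mul, geom_sum_mul]
  have hcyc : cyclotomic (p * q) ℤ * ((X ^ p - 1) * (X ^ q - 1)) =
      (X - 1) * (X ^ (p * q) - 1) := by
    have : Fact p.Prime := ⟨hp⟩
    have h := exists_mul_cyclotomic_mul_prime hq
      (fun h => hpq ((Nat.prime_dvd_prime_iff_eq hq hp).mp h).symm)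
      (by rw [mul_comm]; exact cyclotomic_prime_mul_X_sub_one ℤ p)
    rw [← h, ← cyclotomic_prime_mul_X_sub_one ℤ p]
    simp only [map_sub, expand_X, map_one]
    ring
  have hne : ((X ^ p - 1) * (X ^ q - 1) : ℤ[X]) ≠ 0 :=
    mul_ne_zero (X_pow_sub_C_ne_zero hp.pos 1) (X_pow_sub_C_ne_zero hq.pos 1)
  refine mul_right_cancel₀ hne ?_
  simp only [add_assoc 1, pow_add _ 1, ← Finset.mul_sum]
  rw [hcyc, sub_mul (Finset.sum _ _), mul_assoc, hbox, hbox, pow_one]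
  have e1 : (X : ℤ[X]) ^ (a * p) * X ^ (b * q) = X ^ (p * q) * X := by
    rw [← pow_add, hab, pow_succ]
  have e3 : (X : ℤ[X]) ^ (b * q) * X ^ ((p - b) * q) = X ^ (p * q) := by
    rw [← pow_add, ← add_mul, Nat.add_sub_cancel' (by lia)]
  have e4 : (X : ℤ[X]) * X ^ ((q - a) * p) = X ^ (b * q) := by
    rw [← pow_succ']
    congr 1
    rw [Nat.sub_mul]
    have := Nat.mul_le_mul_right p ha
    nlinarith [Nat.sub_add_cancel this]
  have e5 : (X : ℤ[X]) * X ^ ((p - b) * q) = X ^ (a * p) := by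
    rw [← pow_succ']
    congr 1
    rw [Nat.sub_mul]
    have := Nat.mul_le_mul_right q hb
    nlinarith [Nat.sub_add_cancel this]
  linear_combination -e1 - e4 - e5 + e3 + X ^ ((p - b) * q) * e4

lemma wlen_cyclotomic_prime_mul_prime_le (w : ℕ → ℕ) {p q a b : ℕ} (hp : p.Prime) (hq : q.Prime)
    (hpq : p ≠ q) (ha : a ≤ q) (hb : b ≤ p) (hab : a * p + b * q = p * q + 1) :
    wlen w (cyclotomic (p * q) ℤ) ≤
      ∑ x ∈ Finset.range a ×ˢ Finset.range b, w (x.1 * p + x.2 * q) +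
        ∑ x ∈ Finset.range (q - a) ×ˢ Finset.range (p - b), w (1 + x.1 * p + x.2 * q) := by
  rw [cyclotomic_prime_mul_prime hp hq hpq ha hb hab]
  refine (wlen_sub_le _ _ _).trans (Nat.add_le_add ?_ ?_) <;>
    refine (wlen_sum_le _ _ _).trans (le_of_eq ?_) <;>
    simp only [wlen_X_pow]

lemma two_mul_len_cyclotomic_prime_mul_prime_add_one_le {p q : ℕ} (hp : p.Prime) (hq : q.Prime)
    (hpq : p ≠ q) (hop : Odd p) (hoq : Odd q) : 2 * len (cyclotomic (p * q) ℤ) + 1 ≤ p * q := by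
  obtain ⟨a, b, ha, hb, hab⟩ :=
    exists_nat_mul_add_mul hp.one_lt hq.one_lt ((Nat.coprime_primes hp hq).mpr hpq)
  have h := wlen_cyclotomic_prime_mul_prime_le (fun _ => 1) hp hq hpq ha hb hab
  simp only [Finset.sum_const, Finset.card_product, Finset.card_range, smul_eq_mul,
    mul_one] at h
  have h1 : a * b + (q - a) * (p - b) + 1 = 2 * (a * b) := by
    zify [ha, hb] at hab ⊢
    linear_combination -hab
  have h2 : 4 * (a * b) ≤ p * q + 2 := by
    have h3 : 4 * (a * b) * (p * q) ≤ (p * q + 1) ^ 2 := by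
      rw [← hab]
      have := four_mul_le_sq_add (a * p) (b * q)
      linarith
    have h4 : 1 < p * q := Nat.one_lt_mul_iff.mpr ⟨hp.pos, hq.pos, Or.inl hp.one_lt⟩
    by_contra! h5
    nlinarith
  obtain ⟨c, hc⟩ := hop.mul hoq
  rw [len]
  lia

lemma len_cyclotomic_prime_le {p : ℕ} (hp : p.Prime) : len (cyclotomic p ℤ) ≤ p := by
  have : Fact p.Prime := ⟨hp⟩
  rw [cyclotomic_prime]
  refine (wlen_sum_le _ _ _).trans (le_of_eq ?_)
  simp [wlen_X_pow]

lemma len_X_pow_sub_one_le (n : ℕ) : len (X ^ n - 1) ≤ 2 := by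
  refine (wlen_sub_le _ _ _).trans ?_
  rw [wlen_X_pow, ← pow_zero X, wlen_X_pow]

lemma mul_X_pow_sub_one_mul_cyclotomic {p q : ℕ} (hp : p.Prime) (hq : q.Prime) (hpq : p ≠ q) :
    (cyclotomic p ℤ * (X ^ q - 1)) * cyclotomic (p * q) ℤ = X ^ (p * q) - 1 := by
  have : Fact p.Prime := ⟨hp⟩
  have h := exists_mul_cyclotomic_mul_prime hq
    (fun h => hpq ((Nat.prime_dvd_prime_iff_eq hq hp).mp h).symm)
    (by rw [mul_comm]; exact cyclotomic_prime_mul_X_sub_one ℤ p)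
  simpa using h

lemma injOn_mul_add_mul {p q r : ℕ} (hp : p.Prime) (hq : q.Prime) (hr : r.Prime) (hpq : p ≠ q)
    (hpr : p ≠ r) (hqr : q ≠ r) {a b K : ℕ} (ha : a ≤ q) (hb : b ≤ p) :
    Set.InjOn (fun x : (ℕ × ℕ) × ℕ => r * (x.1.1 * p + x.1.2 * q) + p * q * x.2)
      ((Finset.range a ×ˢ Finset.range b) ×ˢ Finset.range K : Finset ((ℕ × ℕ) × ℕ)) := by
  rintro ⟨⟨x, y⟩, k⟩ hx ⟨⟨x', y'⟩, k'⟩ hx' h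
  simp only [Finset.coe_product, Finset.coe_range, Set.mem_prod, Set.mem_Iio] at hx hx' h
  have cqrp : q.gcd (r * p) = 1 := Nat.Coprime.mul_right ((Nat.coprime_primes hq hr).mpr hqr)
    ((Nat.coprime_primes hq hp).mpr hpq.symm)
  have cprq : p.gcd (r * q) = 1 := Nat.Coprime.mul_right ((Nat.coprime_primes hp hr).mpr hpr)
    ((Nat.coprime_primes hp hq).mpr hpq)
  have h1 : x = x' := by
    refine Nat.ModEq.eq_of_lt_of_lt (Nat.ModEq.cancel_left_of_coprime cqrp ?_)
      (hx.1.1.trans_le ha) (hx'.1.1.trans_le ha)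
    refine (Nat.modEq_iff_dvd).mpr ⟨r * y + p * k - r * y' - p * k', ?_⟩
    zify at h
    push_cast
    linear_combination -h
  have h2 : y = y' := by
    refine Nat.ModEq.eq_of_lt_of_lt (Nat.ModEq.cancel_left_of_coprime cprq ?_)
      (hx.1.2.trans_le hb) (hx'.1.2.trans_le hb)
    refine (Nat.modEq_iff_dvd).mpr ⟨r * x + q * k - r * x' - q * k', ?_⟩
    zify at h
    push_cast
    linear_combination -h
  subst h1 h2
  rw [Nat.eq_of_mul_eq_mul_left (Nat.mul_pos hp.pos hq.pos) (Nat.add_left_cancel h)]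

lemma polyHeight_expand_mul_geom_mul_le_one {p q r K : ℕ} (hp : p.Prime) (hq : q.Prime)
    (hr : r.Prime) (hpq : p ≠ q) (hpr : p ≠ r) (hqr : q ≠ r) :
    polyHeight (expand ℤ r (cyclotomic (p * q) ℤ) *
      (∑ k ∈ Finset.range K, X ^ (p * q * k)) * (X ^ q - 1)) ≤ 1 := by
  obtain ⟨a, b, ha, hb, hab⟩ :=
    exists_nat_mul_add_mul hp.one_lt hq.one_lt ((Nat.coprime_primes hp hq).mpr hpq)
  set S := (Finset.range a ×ˢ Finset.range b) ×ˢ Finset.range K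
  set T := (Finset.range (q - a) ×ˢ Finset.range (p - b)) ×ˢ Finset.range K
  set U : ℤ[X] := ∑ x ∈ S, X ^ (r * (x.1.1 * p + x.1.2 * q) + p * q * x.2) with hU
  set V : ℤ[X] := ∑ x ∈ T, X ^ (r * (1 + x.1.1 * p + x.1.2 * q) + p * q * x.2) with hV
  have hUV : expand ℤ r (cyclotomic (p * q) ℤ) * (∑ k ∈ Finset.range K, X ^ (p * q * k)) =
      U - V := by
    rw [cyclotomic_prime_mul_prime hp hq hpq ha hb hab, hU, hV, map_sub, map_sum, map_sum,
      sub_mul, Finset.sum_mul_sum, Finset.sum_mul_sum, ← Finset.sum_product',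
      ← Finset.sum_product']
    simp only [map_pow, expand_X, ← pow_mul, ← pow_add, S, T]
  have hUc : ∀ n, U.coeff n = 0 ∨ U.coeff n = 1 ∧
      ∃ x ∈ S, r * (x.1.1 * p + x.1.2 * q) + p * q * x.2 = n :=
    coeff_sum_X_pow (injOn_mul_add_mul hp hq hr hpq hpr hqr ha hb)
  have hVc : ∀ n, V.coeff n = 0 ∨ V.coeff n = 1 ∧
      ∃ x ∈ T, r * (1 + x.1.1 * p + x.1.2 * q) + p * q * x.2 = n := by
    refine coeff_sum_X_pow fun x hx y hy h => ?_
    refine injOn_mul_add_mul hp hq hr hpq hpr hqr (Nat.sub_le q a) (Nat.sub_le p b) hx hy ?_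
    simp only at h ⊢
    linarith
  have hdisj : ∀ m n : ℕ, (m : ℤ) ≡ n [ZMOD q] → U.coeff m = 0 ∨ V.coeff n = 0 := by
    intro m n hmn
    rcases hUc m with h | ⟨-, ⟨⟨x, y⟩, k⟩, hx, h1⟩
    · exact Or.inl h
    rcases hVc n with h | ⟨-, ⟨⟨x', y'⟩, k'⟩, hx', h2⟩
    · exact Or.inr h
    exfalso
    simp only [S, T, Finset.mem_product, Finset.mem_range] at hx hx' h1 h2
    have cqrp : q.gcd (r * p) = 1 := Nat.Coprime.mul_right ((Nat.coprime_primes hq hr).mpr hqr)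
      ((Nat.coprime_primes hq hp).mpr hpq.symm)
    have : x = a + x' := by
      refine Nat.ModEq.eq_of_lt_of_lt (Nat.ModEq.cancel_left_of_coprime cqrp ?_)
        (by lia) (by lia)
      obtain ⟨c, hc⟩ := hmn.dvd
      refine (Nat.modEq_iff_dvd).mpr
        ⟨c + r * y + p * k - r * y' - p * k' + r * p - r * b, ?_⟩
      zify at h1 h2 hab
      push_cast
      linear_combination hc + h2 - h1 + r * hab
    lia
  rw [hUV]
  refine polyHeight_le fun n => ?_
  rw [mul_sub, mul_one, coeff_sub, coeff_mul_X_pow']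
  simp only [coeff_sub]
  split_ifs with hn
  · have hm : ((n - q : ℕ) : ℤ) ≡ n [ZMOD q] := by
      rw [Nat.cast_sub hn]
      exact (Int.modEq_iff_dvd).mpr ⟨1, by ring⟩
    have h1 := hdisj n n rfl
    have h2 := hdisj _ _ hm
    have h3 := hdisj _ _ hm.symm
    have h4 := hdisj (n - q) (n - q) rfl
    rcases hUc n with h5 | ⟨h5, -⟩ <;> rcases hVc n with h6 | ⟨h6, -⟩ <;>
      rcases hUc (n - q) with h7 | ⟨h7, -⟩ <;> rcases hVc (n - q) with h8 | ⟨h8, -⟩ <;>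
      simp only [h5, h6, h7, h8] at * <;> first | decide | lia
  · rcases hUc n with h5 | ⟨h5, -⟩ <;> rcases hVc n with h6 | ⟨h6, -⟩ <;>
      rw [h5, h6] <;> decide

lemma A_prime_mul_prime_mul_prime_le {p q r : ℕ} (hp : p.Prime) (hq : q.Prime) (hr : r.Prime)
    (hpq : p ≠ q) (hpr : p ≠ r) (hqr : q ≠ r) : A (p * q * r) ≤ p := by
  have hm : 1 < p * q := Nat.one_lt_mul_iff.mpr ⟨hp.pos, hq.pos, Or.inl hp.one_lt⟩
  have hrm : ¬r ∣ p * q := by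
    rw [hr.dvd_mul, Nat.prime_dvd_prime_iff_eq hr hp, Nat.prime_dvd_prime_iff_eq hr hq]
    lia
  refine A_le_of_mul_X_pow_sub_one
    (Nat.one_lt_mul_iff.mpr ⟨by lia, hr.pos, Or.inl hm⟩) ?_
  rw [cyclotomic_mul_prime_mul_X_pow_sub_one hr hrm (mul_X_pow_sub_one_mul_cyclotomic hp hq hpq),
    mul_comm (cyclotomic p ℤ), ← mul_assoc]
  refine (polyHeight_mul_le _ _).trans ?_
  exact (Nat.mul_le_mul (polyHeight_expand_mul_geom_mul_le_one hp hq hr hpq hpr hqr)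
    (len_cyclotomic_prime_le hp)).trans_eq (one_mul p)

lemma sum_tsub_mul_le {p : ℕ} (m K : ℕ) :
    (2 * p : ℝ) * ((∑ x ∈ Finset.range m, (K - x * p) : ℕ) : ℝ) ≤ (K + p / 2) ^ 2 := by
  induction m generalizing K with
  | zero => simp; positivity
  | succ m ih =>
    rw [Finset.sum_range_succ']
    rcases le_or_gt p K with h | h
    · have e : ∀ x, K - (x + 1) * p = (K - p) - x * p := fun x => by
        rw [Nat.sub_sub]
        congr 1
        ring
      simp only [e]
      have := ih (K - p)
      push_cast [h] at this ⊢
      simp only [zero_mul, Nat.sub_zero]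
      linarith
    · have e : ∀ x, K - (x + 1) * p = 0 := fun x => Nat.sub_eq_zero_of_le (by nlinarith)
      simp only [e, zero_mul, Nat.sub_zero, Finset.sum_const_zero, zero_add]
      nlinarith [sq_nonneg ((K : ℝ) - p / 2)]

lemma sum_sum_tsub_mul_le {p q : ℕ} (m n K : ℕ) :
    (6 * p * q : ℝ) * ((∑ y ∈ Finset.range n, ∑ x ∈ Finset.range m, (K - (x * p + y * q)) : ℕ) : ℝ)
      ≤ (K + (p + q) / 2) ^ 3 := by
  induction n generalizing K with
  | zero => simp; positivity
  | succ n ih =>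
    rw [Finset.sum_range_succ', Nat.cast_add]
    have h0 := sum_tsub_mul_le (p := p) m K
    simp only [zero_mul, add_zero]
    set s : ℝ := ((∑ x ∈ Finset.range m, (K - x * p) : ℕ) : ℝ)
    have hq0 : (0 : ℝ) ≤ q := q.cast_nonneg
    have h1 : 6 * p * q * s ≤ 3 * q * (K + p / 2 : ℝ) ^ 2 := by
      nlinarith [mul_le_mul_of_nonneg_left h0 hq0]
    rcases le_or_gt q K with h | h
    · have e : ∀ x y, K - (x * p + (y + 1) * q) = (K - q) - (x * p + y * q) := fun x y => by
        rw [Nat.sub_sub]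
        congr 1
        ring
      simp only [e]
      have h2 := ih (K - q)
      rw [Nat.cast_sub h] at h2
      have h3 : (0 : ℝ) ≤ q ^ 3 := by positivity
      nlinarith
    · have e : ∀ x y, K - (x * p + (y + 1) * q) = 0 := fun x y =>
        Nat.sub_eq_zero_of_le (by nlinarith)
      simp only [e, Finset.sum_const_zero, Nat.cast_zero, zero_add]
      refine h1.trans ?_
      have hc : (0 : ℝ) ≤ K + p / 2 := by positivity
      rw [show (K + (p + q) / 2 : ℝ) = (K + p / 2) + q / 2 by ring]
      generalize (K + p / 2 : ℝ) = c at hc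
      nlinarith [mul_nonneg hc (sq_nonneg (c - 3 / 4 * q)), mul_nonneg hc (sq_nonneg (q : ℝ)),
        pow_nonneg hq0 3]

lemma wlen_tsub_cyclotomic_prime_mul_prime_le {p q H : ℕ} (hp : p.Prime) (hq : q.Prime)
    (hpq : p ≠ q) (hH : 2 * H = (p - 1) * (q - 1)) (hH0 : 0 < H) :
    (24 * wlen (fun j => H - j) (cyclotomic (p * q) ℤ) : ℝ) ≤ (p * q) ^ 2 + 3 := by
  obtain ⟨a, b, ha, hb, hab⟩ :=
    exists_nat_mul_add_mul hp.one_lt hq.one_lt ((Nat.coprime_primes hp hq).mpr hpq)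
  have h := wlen_cyclotomic_prime_mul_prime_le (fun j => H - j) hp hq hpq ha hb hab
  rw [Finset.sum_product_right, Finset.sum_product_right] at h
  simp only [add_assoc, ← Nat.sub_sub H 1] at h
  have h1 := sum_sum_tsub_mul_le (p := p) (q := q) a b H
  have h2 := sum_sum_tsub_mul_le (p := p) (q := q) (q - a) (p - b) (H - 1)
  have hH' : (2 * H : ℝ) = (p - 1) * (q - 1) := by
    have := congrArg (Nat.cast (R := ℝ)) hH
    push_cast [hp.one_le, hq.one_le] at this
    exact this
  rw [show (H + (p + q) / 2 : ℝ) = (p * q + 1) / 2 by linarith] at h1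
  rw [Nat.cast_sub hH0,
    show (H - (1 : ℕ) + (p + q) / 2 : ℝ) = (p * q - 1) / 2 by push_cast; linarith] at h2
  have h' := (Nat.cast_le (α := ℝ)).mpr h
  rw [Nat.cast_add] at h'
  have hm : (0 : ℝ) < p * q := by
    have := hp.pos
    have := hq.pos
    positivity
  refine le_of_mul_le_mul_left ?_ hm
  nlinarith [mul_le_mul_of_nonneg_left h' hm.le]

lemma mul_wlen_geom_le {N m c r : ℕ} (hm : 0 < m) :
    m * wlen (fun j => if c + j ≤ N then 1 else 0) (∑ k ∈ Finset.range r, X ^ (m * k)) ≤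
      if c ≤ N then N - c + m else 0 := by
  have h1 : wlen (fun j => if c + j ≤ N then 1 else 0) (∑ k ∈ Finset.range r, X ^ (m * k)) ≤
      ∑ k ∈ Finset.range r, if c + m * k ≤ N then 1 else 0 :=
    (wlen_sum_le _ _ _).trans (le_of_eq (by simp only [wlen_X_pow]))
  refine (Nat.mul_le_mul_left m h1).trans ?_
  rw [Finset.sum_boole, Nat.cast_id]
  split_ifs with h
  · have h2 : (Finset.range r).filter (fun k => c + m * k ≤ N) ⊆
        Finset.range ((N - c) / m + 1) := fun k hk => by
      rw [Finset.mem_range_succ_iff, Nat.le_div_iff_mul_le hm, mul_comm]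
      have := (Finset.mem_filter.mp hk).2
      lia
    have h3 := Finset.card_le_card h2
    rw [Finset.card_range] at h3
    have := Nat.mul_div_le (N - c) m
    nlinarith
  · rw [Finset.filter_false_of_mem fun k _ => by lia]
    simp

lemma mul_len_cyclotomic_le {p q r H : ℕ} (hp : p.Prime) (hq : q.Prime) (hr : r.Prime)
    (hpq : p ≠ q) (hpr : p ≠ r) (hqr : q ≠ r)
    (hH : 2 * H = (p - 1) * (q - 1)) (hH0 : 0 < H) :
    q * len (cyclotomic (p * q * r) ℤ) ≤
      4 * r * wlen (fun j => H - j) (cyclotomic (p * q) ℤ) +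
        2 * (p * q) * len (cyclotomic (p * q) ℤ) := by
  have hm : 1 < p * q := Nat.one_lt_mul_iff.mpr ⟨hp.pos, hq.pos, Or.inl hp.one_lt⟩
  have hn : 1 < p * q * r := Nat.one_lt_mul_iff.mpr ⟨by lia, hr.pos, Or.inl hm⟩
  have hrm : ¬r ∣ p * q := by
    rw [hr.dvd_mul, Nat.prime_dvd_prime_iff_eq hr hp, Nat.prime_dvd_prime_iff_eq hr hq]
    lia
  have hφ2 : (p * q).totient = 2 * H := by
    rw [Nat.totient_mul ((Nat.coprime_primes hp hq).mpr hpq), Nat.totient_prime hp,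
      Nat.totient_prime hq, hH]
  have hφ3 : (p * q * r).totient = 2 * (H * (r - 1)) := by
    rw [Nat.totient_mul (hr.coprime_iff_not_dvd.mpr hrm).symm, hφ2, Nat.totient_prime hr,
      mul_assoc]
  set N := H * (r - 1) with hN
  have hNr : N + H = r * H := by
    rw [hN, Nat.mul_sub, mul_one, mul_comm r, Nat.sub_add_cancel]
    exact Nat.le_mul_of_pos_right H hr.pos
  have hNn : N < p * q * r := by
    have := (p * q * r).totient_lt hn
    lia
  set w : ℕ → ℕ := fun j => if j ≤ N then 1 else 0 with hw
  have hanti : Antitone w := fun i j hij => by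
    simp only [hw]
    split_ifs <;> lia
  set Φ := cyclotomic (p * q) ℤ
  set S : ℤ[X] := ∑ k ∈ Finset.range r, X ^ (p * q * k)
  set Ψ : ℤ[X] := cyclotomic p ℤ * (X ^ q - 1)
  have hΨ : len Ψ ≤ p * 2 := (len_mul_le _ _).trans
    (Nat.mul_le_mul (len_cyclotomic_prime_le hp) (len_X_pow_sub_one_le q))
  have h1 : wlen w (cyclotomic (p * q * r) ℤ) = wlen w (expand ℤ r Φ * S * Ψ) := by
    rw [← cyclotomic_mul_prime_mul_X_pow_sub_one hr hrm
      (mul_X_pow_sub_one_mul_cyclotomic hp hq hpq)]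
    refine wlen_congr fun j hj => (natAbs_coeff_mul_X_pow_sub_one ?_).symm
    simp only [hw, ne_eq, ite_eq_right_iff, one_ne_zero, imp_false, not_not] at hj
    lia
  have h2 : wlen w (expand ℤ r Φ * S) ≤ wlen (fun j => wlen (fun i => w (r * j + i)) S) Φ :=
    (wlen_mul_le _ _ _).trans (wlen_expand_le _ _ _)
  have h3 : p * q * wlen (fun j => wlen (fun i => w (r * j + i)) S) Φ ≤
      r * wlen (fun j => H - j) Φ + p * q * wlen (fun j => if j < H then 1 else 0) Φ := by
    have h4 := wlen_linear (p * q) 0 (fun j => wlen (fun i => w (r * j + i)) S) (fun _ => 0) Φ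
    simp only [zero_mul, add_zero] at h4
    rw [← wlen_linear, ← h4]
    refine wlen_le_wlen (fun j => ?_) Φ
    refine (mul_wlen_geom_le (by lia)).trans ?_
    split_ifs with h5 h6 h6
    · rw [mul_one, Nat.mul_sub]
      lia
    · have : r * H ≤ r * j := Nat.mul_le_mul_left r (not_lt.mp h6)
      lia
    · exact Nat.zero_le _
    · exact Nat.zero_le _
  have h4 : wlen w (cyclotomic (p * q * r) ℤ) ≤ wlen w (expand ℤ r Φ * S) * (p * 2) := by
    rw [h1]
    exact (wlen_mul_le_of_antitone hanti _ _).trans (Nat.mul_le_mul_left _ hΨ)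
  have h5 : len (cyclotomic (p * q * r) ℤ) ≤ 2 * wlen w (cyclotomic (p * q * r) ℤ) :=
    len_cyclotomic_le hn hφ3
  have h6 : 2 * wlen (fun j => if j < H then 1 else 0) Φ ≤ len Φ :=
    two_mul_wlen_cyclotomic_le_len hm hφ2
  calc q * len (cyclotomic (p * q * r) ℤ)
      ≤ q * (2 * (wlen (fun j => wlen (fun i => w (r * j + i)) S) Φ * (p * 2))) := by
        refine Nat.mul_le_mul_left q (h5.trans (Nat.mul_le_mul_left 2 (h4.trans ?_)))
        exact Nat.mul_le_mul_right _ h2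
    _ = 4 * (p * q * wlen (fun j => wlen (fun i => w (r * j + i)) S) Φ) := by ring
    _ ≤ 4 * (r * wlen (fun j => H - j) Φ + p * q * wlen (fun j => if j < H then 1 else 0) Φ) :=
        Nat.mul_le_mul_left 4 h3
    _ ≤ _ := by nlinarith [Nat.mul_le_mul_left (p * q) h6]

lemma A_mul_five_primes_le {p q r s t : ℕ} (hp : p.Prime) (hq : q.Prime) (hr : r.Prime)
    (hs : s.Prime) (ht : t.Prime) (hpq : p < q) (hqr : q < r) (hrs : r < s) (hst : s < t) :
    A (p * q * r * s * t) ≤ p * (len (cyclotomic (p * q) ℤ) * (p * 2)) *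
      (len (cyclotomic (p * q * r) ℤ) * (len (cyclotomic (p * q) ℤ) * (p * 2))) := by
  have hm : 1 < p * q := Nat.one_lt_mul_iff.mpr ⟨hp.pos, hq.pos, Or.inl hp.one_lt⟩
  have hn : 1 < p * q * r := Nat.one_lt_mul_iff.mpr ⟨by lia, hr.pos, Or.inl hm⟩
  have hk : 1 < p * q * r * s := Nat.one_lt_mul_iff.mpr ⟨by lia, hs.pos, Or.inl hn⟩
  have hrm : ¬r ∣ p * q := by
    rw [hr.dvd_mul, Nat.prime_dvd_prime_iff_eq hr hp, Nat.prime_dvd_prime_iff_eq hr hq]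
    lia
  have hsn : ¬s ∣ p * q * r := by
    rw [hs.dvd_mul, hs.dvd_mul, Nat.prime_dvd_prime_iff_eq hs hp,
      Nat.prime_dvd_prime_iff_eq hs hq, Nat.prime_dvd_prime_iff_eq hs hr]
    lia
  have htk : ¬t ∣ p * q * r * s := by
    rw [ht.dvd_mul, ht.dvd_mul, ht.dvd_mul, Nat.prime_dvd_prime_iff_eq ht hp,
      Nat.prime_dvd_prime_iff_eq ht hq, Nat.prime_dvd_prime_iff_eq ht hr,
      Nat.prime_dvd_prime_iff_eq ht hs]
    lia
  have hΨ2 := mul_X_pow_sub_one_mul_cyclotomic hp hq hpq.ne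
  have hΨ3 := exists_mul_cyclotomic_mul_prime hr hrm hΨ2
  have hΨ4 := exists_mul_cyclotomic_mul_prime hs hsn hΨ3
  have h2 : len (cyclotomic p ℤ * (X ^ q - 1)) ≤ p * 2 := (len_mul_le _ _).trans
    (Nat.mul_le_mul (len_cyclotomic_prime_le hp) (len_X_pow_sub_one_le q))
  have h3 := (len_mul_le (cyclotomic (p * q) ℤ) _).trans
    (Nat.mul_le_mul_left _ ((len_expand_le r _).trans h2))
  have h4 := (len_mul_le (cyclotomic (p * q * r) ℤ) _).trans
    (Nat.mul_le_mul_left _ ((len_expand_le s _).trans h3))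
  refine (A_mul_prime_le hk ht htk hΨ4).trans (Nat.mul_le_mul ?_ h4)
  refine (A_mul_prime_le hn hs hsn hΨ3).trans (Nat.mul_le_mul ?_ h3)
  exact A_prime_mul_prime_mul_prime_le hp hq hr hpq.ne (hpq.trans hqr).ne hqr.ne

/-- The numerical inequality behind the constant `135 / 512`; it is nearly sharp at
`m = 15`, `r = 7`. -/
lemma sub_one_sq_mul_le {m r : ℝ} (hm : 15 ≤ m) (h : 11 ≤ r ∨ m = 15 ∧ r = 7) :
    (m - 1) ^ 2 * (r * (m ^ 2 + 3) / 6 + m * (m - 1)) ≤ 135 / 512 * m ^ 4 * r := by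
  rcases h with h | ⟨rfl, rfl⟩
  · have h1 : (m - 1) ^ 2 * (m ^ 2 + 3) ≤ m ^ 4 := by nlinarith [sq_nonneg m]
    have h2 : (m - 1) ^ 3 * m ≤ m ^ 4 := by
      rw [show m ^ 4 = m ^ 3 * m by ring]
      gcongr
      linarith
      linarith
    have h3 : m ^ 4 * 11 ≤ m ^ 4 * r := by gcongr
    have h4 := mul_le_mul_of_nonneg_left h1 (show 0 ≤ r by linarith)
    have h5 : 0 ≤ m ^ 4 := by positivity
    nlinarith
  · norm_num

/-- **(Bzdęga, bound (5)).** For odd primes `p < q < r < s < t`,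
`A (pqrst) ≤ (135/512)·p⁷q³r`. -/
theorem height_cyclotomic_stmt10 (p q r s t : ℕ)
    (hp : p.Prime) (hq : q.Prime) (hr : r.Prime) (hs : s.Prime) (ht : t.Prime)
    (hop : Odd p) (hoq : Odd q) (hor : Odd r) (hos : Odd s) (hot : Odd t)
    (hpq : p < q) (hqr : q < r) (hrs : r < s) (hst : s < t) :
    (A (p * q * r * s * t) : ℝ) ≤ (135 / 512) * (p : ℝ) ^ 7 * (q : ℝ) ^ 3 * r := by
  have hp3 : 3 ≤ p := by
    have := hp.two_le
    rcases hop with ⟨c, hc⟩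
    lia
  have hq5 : 5 ≤ q := by
    rcases hoq with ⟨c, hc⟩
    rcases hop with ⟨d, hd⟩
    lia
  have hcases : 11 ≤ r ∨ (p * q = 15 ∧ r = 7) := by
    by_contra! h
    have h9 : r ≠ 9 := fun h => by rw [h] at hr; norm_num at hr
    have h7 : r = 7 := by
      rcases hor with ⟨c, hc⟩
      rcases hoq with ⟨d, hd⟩
      lia
    have hq' : q = 5 := by
      rcases hoq with ⟨d, hd⟩
      lia
    have hp' : p = 3 := by
      rcases hop with ⟨d, hd⟩
      lia
    exact h.2 (by rw [hp', hq']) h7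
  obtain ⟨H, hH⟩ : ∃ H, 2 * H = (p - 1) * (q - 1) := by
    obtain ⟨c, hc⟩ := hop
    exact ⟨c * (q - 1), by rw [hc, Nat.add_sub_cancel, mul_assoc]⟩
  have hH0 : 0 < H := by
    have : 0 < (p - 1) * (q - 1) := Nat.mul_pos (by lia) (by lia)
    lia
  have hA := A_mul_five_primes_le hp hq hr hs ht hpq hqr hrs hst
  have hL := mul_len_cyclotomic_le hp hq hr hpq.ne (hpq.trans hqr).ne hqr.ne hH hH0
  have hG := wlen_tsub_cyclotomic_prime_mul_prime_le hp hq hpq.ne hH hH0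
  have hΛ := two_mul_len_cyclotomic_prime_mul_prime_add_one_le hp hq hpq.ne hop hoq
  have hm : (15 : ℝ) ≤ (p : ℝ) * q := by
    exact_mod_cast Nat.mul_le_mul hp3 hq5
  have hnum := sub_one_sq_mul_le (m := (p : ℝ) * q) (r := r) hm (by
    rcases hcases with h | ⟨h, h'⟩
    · exact Or.inl (by exact_mod_cast h)
    · exact Or.inr ⟨by exact_mod_cast h, by exact_mod_cast h'⟩)
  generalize len (cyclotomic (p * q) ℤ) = Λ at *
  generalize len (cyclotomic (p * q * r) ℤ) = L at *
  generalize wlen (fun j => H - j) (cyclotomic (p * q) ℤ) = G at *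
  replace hA : (A (p * q * r * s * t) : ℝ) ≤ p ^ 3 * (2 * Λ) ^ 2 * L := by
    refine (Nat.cast_le.mpr hA).trans (le_of_eq ?_)
    push_cast
    ring
  replace hΛ : (2 * Λ : ℝ) ≤ p * q - 1 := by
    have : ((2 * Λ + 1 : ℕ) : ℝ) ≤ ((p * q : ℕ) : ℝ) := Nat.cast_le.mpr hΛ
    push_cast at this
    linarith
  replace hL : (q * L : ℝ) ≤ r * ((p * q) ^ 2 + 3) / 6 + (p * q) * (p * q - 1) := by
    have h1 : ((q * L : ℕ) : ℝ) ≤ ((4 * r * G + 2 * (p * q) * Λ : ℕ) : ℝ) := Nat.cast_le.mpr hL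
    push_cast at h1
    have h2 := mul_le_mul_of_nonneg_left hG (r.cast_nonneg (α := ℝ))
    have h3 := mul_le_mul_of_nonneg_left hΛ (show (0 : ℝ) ≤ p * q by positivity)
    linarith
  refine hA.trans ?_
  have hq0 : (0 : ℝ) < q := by exact_mod_cast hq.pos
  refine le_of_mul_le_mul_left ?_ hq0
  calc (q : ℝ) * (p ^ 3 * (2 * Λ) ^ 2 * L) = (p : ℝ) ^ 3 * ((2 * Λ) ^ 2 * (q * L)) := by ring
    _ ≤ (p : ℝ) ^ 3 * (((p : ℝ) * q - 1) ^ 2 *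
          (r * (((p : ℝ) * q) ^ 2 + 3) / 6 + (p * q) * ((p : ℝ) * q - 1))) := by
        gcongr
    _ ≤ (p : ℝ) ^ 3 * (135 / 512 * ((p : ℝ) * q) ^ 4 * r) :=
        mul_le_mul_of_nonneg_left hnum (by positivity)
    _ = q * (135 / 512 * (p : ℝ) ^ 7 * (q : ℝ) ^ 3 * r) := by ring
end
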